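/- arXiv:0908.4400 — 6 statements merged into one kernel-verified Lean document; each statement's English description precedes it below -/
import Mathlib

section
/- Let f be a log-concave density on ℝ^d. Then there exist a > 0 and b ∈ ℝ such that f(x) ≤ exp(−a‖x‖ + b) for all x ∈ ℝ^d. -/
open MeasureTheory

/-- A log-concave probability density on ℝ^d (with respect to Lebesgue measure):
nonnegative, measurable, integrates to one, and `log f` is concave, expressed
equivalently (avoiding extended reals) by the multiplicative inequality
`f x ^ s * f y ^ t ≤ f (s • x + t • y)` for convex combinations. -/
def IsLogConcaveDensity {d : ℕ} (f : EuclideanSpace ℝ (Fin d) → ℝ) : Prop :=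
  Measurable f ∧ (∀ x, 0 ≤ f x) ∧ (∫ x, f x = 1) ∧
    ∀ x y : EuclideanSpace ℝ (Fin d), ∀ s t : ℝ, 0 ≤ s → 0 ≤ t → s + t = 1 →
      f x ^ s * f y ^ t ≤ f (s • x + t • y)

/-- The integral of an integrable function over the complement of large balls is small. -/
lemma exists_setIntegral_compl_ball_lt {E : Type*} [NormedAddCommGroup E] [MeasurableSpace E]
    [BorelSpace E] {μ : Measure E} {f : E → ℝ} (hint : Integrable f μ) {ε : ℝ} (hε : 0 < ε) :
    ∃ n : ℕ, ∫ x in (Metric.ball 0 n)ᶜ, f x ∂μ < ε := by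
  have hlim := tendsto_setIntegral_of_antitone (μ := μ) (f := f)
    (s := fun n : ℕ ↦ (Metric.ball (0 : E) n)ᶜ) (fun n ↦ measurableSet_ball.compl)
    (fun m n hmn ↦ Set.compl_subset_compl.2 (Metric.ball_subset_ball (by exact_mod_cast hmn)))
    ⟨0, hint.integrableOn⟩
  rw [← Set.compl_iUnion, Metric.iUnion_ball_nat, Set.compl_univ, setIntegral_empty] at hlim
  exact (hlim.eventually (gt_mem_nhds hε)).exists

section LogConcave

variable {E : Type*} [NormedAddCommGroup E] [NormedSpace ℝ E] {f : E → ℝ}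

/-- Superlevel sets of a log-concave function are convex. -/
lemma convex_superlevel_of_logConcave
    (hlc : ∀ x y : E, ∀ s t : ℝ, 0 ≤ s → 0 ≤ t → s + t = 1 →
      f x ^ s * f y ^ t ≤ f (s • x + t • y))
    {c : ℝ} (hc : 0 < c) : Convex ℝ {x | c ≤ f x} := by
  intro x hx y hy s t hs ht hst
  calc c = c ^ s * c ^ t := by rw [← Real.rpow_add hc, hst, Real.rpow_one]
    _ ≤ f x ^ s * f y ^ t :=
      mul_le_mul (Real.rpow_le_rpow hc.le hx hs) (Real.rpow_le_rpow hc.le hy ht)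
        (Real.rpow_nonneg hc.le _) (Real.rpow_nonneg (hc.le.trans hx) _)
    _ ≤ f (s • x + t • y) := hlc x y s t hs ht hst

/-- A log-concave function which is small on a sphere around `x₀`, compared to a lower bound for
its value at `x₀`, decays exponentially outside of that sphere. -/
lemma le_exp_of_logConcave_of_sphere (hnn : ∀ x, 0 ≤ f x)
    (hlc : ∀ x y : E, ∀ s t : ℝ, 0 ≤ s → 0 ≤ t → s + t = 1 →
      f x ^ s * f y ^ t ≤ f (s • x + t • y))
    {c R : ℝ} {x₀ : E} (hc : 0 < c) (hx₀ : c ≤ f x₀) (hR : 0 < R)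
    (hsphere : ∀ y, ‖y - x₀‖ = R → f y ≤ c * Real.exp (-1)) {x : E} (hx : R ≤ ‖x - x₀‖) :
    f x ≤ c * Real.exp (-(‖x - x₀‖ / R)) := by
  have hN : 0 < ‖x - x₀‖ := hR.trans_le hx
  set t := R / ‖x - x₀‖ with ht
  have ht0 : 0 < t := div_pos hR hN
  have ht1 : t ≤ 1 := (div_le_one hN).2 hx
  have hinv : ‖x - x₀‖ / R = t⁻¹ := by rw [ht, inv_div]
  rw [hinv]
  have hy : ‖((1 - t) • x₀ + t • x) - x₀‖ = R := by
    rw [show ((1 - t) • x₀ + t • x) - x₀ = t • (x - x₀) by module, norm_smul,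
      Real.norm_of_nonneg ht0.le, ht, div_mul_cancel₀ _ hN.ne']
  have h1 : c ^ (1 - t) * f x ^ t ≤ c * Real.exp (-1) :=
    calc c ^ (1 - t) * f x ^ t ≤ f x₀ ^ (1 - t) * f x ^ t :=
          mul_le_mul_of_nonneg_right (Real.rpow_le_rpow hc.le hx₀ (by linarith))
            (Real.rpow_nonneg (hnn x) _)
      _ ≤ f ((1 - t) • x₀ + t • x) := hlc _ _ _ _ (by linarith) ht0.le (by ring)
      _ ≤ c * Real.exp (-1) := hsphere _ hy
  have hexp : Real.exp (-t⁻¹) ^ t = Real.exp (-1) := by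
    rw [← Real.exp_mul, neg_mul, inv_mul_cancel₀ ht0.ne']
  have h2 : c * Real.exp (-1) = c ^ (1 - t) * (c * Real.exp (-t⁻¹)) ^ t := by
    rw [Real.mul_rpow hc.le (Real.exp_pos _).le, hexp, ← mul_assoc, ← Real.rpow_add hc,
      sub_add_cancel, Real.rpow_one]
  rw [h2] at h1
  exact (Real.rpow_le_rpow_iff (hnn x) (by positivity) ht0).1
    (le_of_mul_le_mul_left h1 (Real.rpow_pos_of_pos hc _))

variable [MeasurableSpace E] [BorelSpace E] [FiniteDimensional ℝ E] {μ : Measure E}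
  [μ.IsAddHaarMeasure]

/-- A log-concave function with positive integral is bounded below on some ball. -/
lemma exists_ball_le_of_logConcave
    (hlc : ∀ x y : E, ∀ s t : ℝ, 0 ≤ s → 0 ≤ t → s + t = 1 →
      f x ^ s * f y ^ t ≤ f (s • x + t • y))
    (hint : 0 < ∫ x, f x ∂μ) :
    ∃ c > 0, ∃ x₀, ∃ r > 0, ∀ x ∈ Metric.ball x₀ r, c ≤ f x := by
  obtain ⟨n, hn⟩ : ∃ n : ℕ, μ {x | 1 / ((n : ℝ) + 1) ≤ f x} ≠ 0 := by
    by_contra! h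
    refine hint.not_ge (integral_nonpos_of_ae ?_)
    filter_upwards [ae_all_iff.2 fun n : ℕ ↦ measure_eq_zero_iff_ae_notMem.1 (h n)] with x hx
    by_contra! hpos
    obtain ⟨n, hn⟩ := exists_nat_one_div_lt hpos
    exact hx n hn.le
  have hc : (0 : ℝ) < 1 / ((n : ℝ) + 1) := by positivity
  have hconv := convex_superlevel_of_logConcave hlc hc
  have hne : (interior {x | 1 / ((n : ℝ) + 1) ≤ f x}).Nonempty := by
    by_contra hempty
    rw [Set.not_nonempty_iff_eq_empty] at hempty
    refine hn (measure_mono_null ?_ (hconv.addHaar_frontier μ))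
    rw [frontier, hempty, Set.sdiff_empty]
    exact subset_closure
  obtain ⟨x₀, hx₀⟩ := hne
  obtain ⟨r, hr, hball⟩ := Metric.mem_nhds_iff.1 (mem_interior_iff_mem_nhds.1 hx₀)
  exact ⟨_, hc, x₀, r, hr, hball⟩

/-- If a log-concave function is at least `c` on the ball of radius `r` around `x₀`, its value at
`x` is controlled by its integral over a ball around the midpoint of `x₀` and `x`. -/
lemma sqrt_mul_measure_ball_le_setIntegral_of_logConcave (hnn : ∀ x, 0 ≤ f x)
    (hlc : ∀ x y : E, ∀ s t : ℝ, 0 ≤ s → 0 ≤ t → s + t = 1 →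
      f x ^ s * f y ^ t ≤ f (s • x + t • y))
    (hint : Integrable f μ) {c r : ℝ} {x₀ : E} (hc : 0 < c)
    (hball : ∀ x ∈ Metric.ball x₀ r, c ≤ f x) (x : E) :
    √(c * f x) * μ.real (Metric.ball 0 (r / 2)) ≤
      ∫ z in Metric.ball ((1 / 2 : ℝ) • (x₀ + x)) (r / 2), f z ∂μ := by
  have hμ : μ.real (Metric.ball 0 (r / 2)) =
      μ.real (Metric.ball ((1 / 2 : ℝ) • (x₀ + x)) (r / 2)) := by
    rw [measureReal_def, measureReal_def, Measure.addHaar_ball_center μ (_ • _)]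
  rw [hμ]
  refine setIntegral_ge_of_const_le_real measurableSet_ball measure_ball_lt_top.ne
    (fun z hz ↦ ?_) hint.integrableOn
  have hw : (2 : ℝ) • z - x ∈ Metric.ball x₀ r := by
    rw [mem_ball_iff_norm] at hz ⊢
    rw [show (2 : ℝ) • z - x - x₀ = (2 : ℝ) • (z - (1 / 2 : ℝ) • (x₀ + x)) by module, norm_smul,
      Real.norm_of_nonneg zero_le_two]
    linarith
  calc √(c * f x) = c ^ (1 / 2 : ℝ) * f x ^ (1 / 2 : ℝ) := by
        rw [Real.sqrt_eq_rpow, Real.mul_rpow hc.le (hnn x)]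
    _ ≤ f ((2 : ℝ) • z - x) ^ (1 / 2 : ℝ) * f x ^ (1 / 2 : ℝ) :=
        mul_le_mul_of_nonneg_right (Real.rpow_le_rpow hc.le (hball _ hw) (by norm_num))
          (Real.rpow_nonneg (hnn x) _)
    _ ≤ f ((1 / 2 : ℝ) • ((2 : ℝ) • z - x) + (1 / 2 : ℝ) • x) :=
        hlc _ _ _ _ (by norm_num) (by norm_num) (by norm_num)
    _ = f z := by congr 1; module

/-- An integrable log-concave function with positive integral decays exponentially. -/
theorem exists_le_exp_of_logConcave (hnn : ∀ x, 0 ≤ f x)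
    (hlc : ∀ x y : E, ∀ s t : ℝ, 0 ≤ s → 0 ≤ t → s + t = 1 →
      f x ^ s * f y ^ t ≤ f (s • x + t • y))
    (hint : Integrable f μ) (hpos : 0 < ∫ x, f x ∂μ) :
    ∃ a > (0 : ℝ), ∃ b : ℝ, ∀ x, f x ≤ Real.exp (-a * ‖x‖ + b) := by
  obtain ⟨c, hc, x₀, r, hr, hball⟩ := exists_ball_le_of_logConcave hlc hpos
  have hmid := sqrt_mul_measure_ball_le_setIntegral_of_logConcave hnn hlc hint hc hball
  set v := μ.real (Metric.ball (0 : E) (r / 2)) with hv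
  have hv0 : 0 < v :=
    ENNReal.toReal_pos (Metric.measure_ball_pos μ _ (by positivity)).ne' measure_ball_lt_top.ne
  have hle : ∀ {A x}, √(c * f x) * v ≤ A * v → f x ≤ A ^ 2 / c := by
    intro A x h
    have hA := le_of_mul_le_mul_right h hv0
    have hsq := (Real.sqrt_le_left ((Real.sqrt_nonneg _).trans hA)).1 hA
    rw [le_div_iff₀ hc]
    linarith
  obtain ⟨M, hM⟩ : ∃ M, ∀ x, f x ≤ M := by
    refine ⟨((∫ x, f x ∂μ) / v) ^ 2 / c, fun x ↦ hle ?_⟩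
    rw [div_mul_cancel₀ _ hv0.ne']
    exact (hmid x).trans (setIntegral_le_integral hint (Filter.Eventually.of_forall hnn))
  obtain ⟨R, hR, hfar⟩ : ∃ R > 0, ∀ y, ‖y - x₀‖ = R → f y ≤ c * Real.exp (-1) := by
    obtain ⟨n, hn⟩ := exists_setIntegral_compl_ball_lt hint
      (show 0 < c * Real.exp (-(1 / 2)) * v by positivity)
    refine ⟨2 * n + r + 2 * ‖x₀‖, by positivity, fun y hy ↦ ?_⟩
    have hsub : Metric.ball ((1 / 2 : ℝ) • (x₀ + y)) (r / 2) ⊆ (Metric.ball 0 n)ᶜ := by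
      intro z hz hzn
      rw [mem_ball_iff_norm] at hz
      rw [mem_ball_zero_iff] at hzn
      have h1 : ‖y - x₀‖ ≤ ‖(2 : ℝ) • z‖ + ‖(2 : ℝ) • (z - (1 / 2 : ℝ) • (x₀ + y))‖
          + ‖(2 : ℝ) • x₀‖ := by
        rw [show y - x₀ =
          (2 : ℝ) • z - (2 : ℝ) • (z - (1 / 2 : ℝ) • (x₀ + y)) - (2 : ℝ) • x₀ by module]
        exact (norm_sub_le _ _).trans (add_le_add_left (norm_sub_le _ _) _)
      simp only [norm_smul, Real.norm_ofNat] at h1 hz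
      linarith
    have h2 := hle ((hmid y).trans ((setIntegral_mono_set hint.integrableOn
      (Filter.Eventually.of_forall hnn) hsub.eventuallyLE).trans hn.le))
    refine h2.trans_eq ?_
    rw [mul_pow, ← Real.exp_nat_mul]
    field_simp
    norm_num
  have hMpos : 0 < M := hc.trans_le ((hball x₀ (Metric.mem_ball_self hr)).trans (hM x₀))
  refine ⟨1 / R, by positivity, max (Real.log c) (Real.log M + 1) + ‖x₀‖ / R, fun x ↦ ?_⟩
  have hx : ‖x‖ / R ≤ ‖x - x₀‖ / R + ‖x₀‖ / R := by
    rw [← add_div]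
    gcongr
    simpa using norm_add_le (x - x₀) x₀
  have hrw : -(1 / R) * ‖x‖ = -(‖x‖ / R) := by ring
  rw [hrw]
  rcases le_or_gt R ‖x - x₀‖ with h | h
  · refine (le_exp_of_logConcave_of_sphere hnn hlc hc (hball x₀ (Metric.mem_ball_self hr)) hR
      hfar h).trans ?_
    nth_rewrite 1 [← Real.exp_log hc]
    rw [← Real.exp_add, Real.exp_le_exp]
    linarith [le_max_left (Real.log c) (Real.log M + 1)]
  · refine (hM x).trans ?_
    nth_rewrite 1 [← Real.exp_log hMpos]
    rw [Real.exp_le_exp]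
    linarith [le_max_right (Real.log c) (Real.log M + 1), (div_lt_one hR).2 h]

end LogConcave

/-- Lemma 1: a log-concave density has exponentially decaying tails. -/
theorem logConcave_exp_bound {d : ℕ} (f : EuclideanSpace ℝ (Fin d) → ℝ)
    (hf : IsLogConcaveDensity f) :
    ∃ a > (0 : ℝ), ∃ b : ℝ, ∀ x, f x ≤ Real.exp (-a * ‖x‖ + b) := by
  obtain ⟨-, hnn, hone, hlc⟩ := hf
  exact exists_le_exp_of_logConcave hnn hlc
    (Integrable.of_integral_ne_zero (hone.trans_ne one_ne_zero)) (hone ▸ one_pos)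
end

section
/- Let f be a log-concave density on ℝ^d such that log f : ℝ^d → [−∞,∞) is upper semicontinuous (i.e. the concave function log f is closed). Then f attains its maximum: there exists x₀ ∈ ℝ^d with f(x₀) = sup_{x ∈ ℝ^d} f(x). -/
open MeasureTheory

/-- In a finite-dimensional space, a convex set of positive Haar measure has nonempty interior. -/
theorem Convex.interior_nonempty_of_addHaar_ne_zero {E : Type*} [NormedAddCommGroup E]
    [NormedSpace ℝ E] [FiniteDimensional ℝ E] [MeasurableSpace E] [BorelSpace E]
    (μ : Measure E) [μ.IsAddHaarMeasure] {S : Set E} (hS : Convex ℝ S) (h : μ S ≠ 0) :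
    (interior S).Nonempty := by
  rw [hS.interior_nonempty_iff_affineSpan_eq_top]
  by_contra hspan
  exact h (measure_mono_null (subset_affineSpan ℝ S) (Measure.addHaar_affineSubspace μ _ hspan))

/-- A convex set with nonempty interior and finite Haar measure is bounded. -/
theorem Convex.isBounded_of_addHaar_ne_top {E : Type*} [NormedAddCommGroup E]
    [NormedSpace ℝ E] [MeasurableSpace E] [BorelSpace E]
    (μ : Measure E) [μ.IsAddHaarMeasure] {S : Set E} (hS : Convex ℝ S)
    (hint : (interior S).Nonempty) (hfin : μ S ≠ ⊤) : Bornology.IsBounded S := by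
  by_contra hunb
  obtain ⟨x, hx⟩ := hint
  obtain ⟨r, hr, hball⟩ := Metric.isOpen_iff.1 isOpen_interior x hx
  have hballS : Metric.ball x r ⊆ S := hball.trans interior_subset
  have : Std.Symm fun a b : E => 2 * r ≤ dist a b := ⟨fun a b h => by rwa [dist_comm]⟩
  obtain ⟨y, hyS, hysep⟩ := exists_seq_of_forall_finset_exists' (· ∈ S)
    (fun a b : E => 2 * r ≤ dist a b) (by
      intro s _
      by_contra! hcon
      refine hunb (Bornology.IsBounded.subset
        (s.finite_toSet.isBounded.thickening (δ := 2 * r)) fun z hz => ?_)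
      obtain ⟨a, ha, haz⟩ := hcon z hz
      exact Metric.mem_thickening_iff.2 ⟨a, ha, by rwa [dist_comm]⟩)
  set c : ℕ → E := fun n => midpoint ℝ x (y n) with hc
  have hsub : ∀ n, Metric.ball (c n) (r / 2) ⊆ S := by
    intro n z hz
    have hw : x + (2 : ℝ) • (z - c n) ∈ S := hballS (by
      rw [mem_ball_iff_norm] at hz ⊢
      rw [add_sub_cancel_left, norm_smul, Real.norm_two]
      linarith)
    have hmid := hS.midpoint_mem hw (hyS n)
    convert hmid using 1
    simp only [hc, midpoint_eq_smul_add, invOf_eq_inv]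
    module
  have hdisj : Pairwise (Function.onFun Disjoint fun n => Metric.ball (c n) (r / 2)) := by
    intro m n hmn
    apply Metric.ball_disjoint_ball
    have h1 := hysep hmn
    have h2 : dist (c m) (c n) = 2⁻¹ * dist (y m) (y n) := by
      rw [dist_eq_norm, dist_eq_norm, show c m - c n = (2⁻¹ : ℝ) • (y m - y n) by
        simp only [hc, midpoint_eq_smul_add, invOf_eq_inv]; module, norm_smul]
      norm_num
    linarith
  apply hfin
  rw [eq_top_iff]
  calc ⊤ = ∑' _ : ℕ, μ (Metric.ball 0 (r / 2)) :=
        (ENNReal.tsum_const_eq_top_of_ne_zero (Metric.measure_ball_pos μ 0 (half_pos hr)).ne').symm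
    _ = ∑' n, μ (Metric.ball (c n) (r / 2)) := by
        simp_rw [Measure.addHaar_ball_center]
    _ = μ (⋃ n, Metric.ball (c n) (r / 2)) :=
        (measure_iUnion hdisj fun _ => Metric.isOpen_ball.measurableSet).symm
    _ ≤ μ S := measure_mono (Set.iUnion_subset hsub)

namespace IsLogConcaveDensity

variable {d : ℕ} {f : EuclideanSpace ℝ (Fin d) → ℝ}

theorem integrable (hf : IsLogConcaveDensity f) : Integrable f := by
  by_contra h
  have := hf.2.2.1
  rw [integral_undef h] at this
  exact zero_ne_one this

theorem convex_superlevel (hf : IsLogConcaveDensity f) {c : ℝ} (hc : 0 < c) :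
    Convex ℝ {x | c ≤ f x} := by
  intro x hx y hy s t hs ht hst
  calc c = c ^ s * c ^ t := by rw [← Real.rpow_add hc, hst, Real.rpow_one]
    _ ≤ f x ^ s * f y ^ t := by
        have := hf.2.1 x
        have hx' : c ≤ f x := hx
        have hy' : c ≤ f y := hy
        gcongr
    _ ≤ f (s • x + t • y) := hf.2.2.2 x y s t hs ht hst

theorem exists_volume_superlevel_ne_zero (hf : IsLogConcaveDensity f) :
    ∃ c, 0 < c ∧ volume {x | c ≤ f x} ≠ 0 := by
  by_contra! hcon
  have hae : ∀ᵐ x, ∀ n : ℕ, f x < 1 / ((n : ℝ) + 1) := by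
    refine ae_all_iff.2 fun n => ?_
    simpa only [ae_iff, not_lt] using hcon _ Nat.one_div_pos_of_nat
  have hzero : f =ᵐ[volume] 0 := by
    filter_upwards [hae] with x hx
    refine le_antisymm (le_of_forall_pos_lt_add fun ε hε => ?_) (hf.2.1 x)
    obtain ⟨n, hn⟩ := exists_nat_one_div_lt hε
    simpa using (hx n).trans hn
  have := hf.2.2.1
  rw [integral_congr_ae hzero] at this
  simp at this

end IsLogConcaveDensity

/-- A log-concave density whose logarithm is a closed (equivalently, upper
semicontinuous) concave function attains its maximum.  Since `x ↦ log x` and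
`x ↦ exp x` are continuous and monotone, upper semicontinuity of `log f`
(with values in `[−∞,∞)`) is equivalent to upper semicontinuity of `f`. -/
theorem logConcave_closed_attains_max {d : ℕ} (f : EuclideanSpace ℝ (Fin d) → ℝ)
    (hf : IsLogConcaveDensity f) (husc : UpperSemicontinuous f) :
    ∃ x₀, ∀ x, f x ≤ f x₀ := by
  obtain ⟨c, hc, hvol⟩ := hf.exists_volume_superlevel_ne_zero
  have hconv := hf.convex_superlevel hc
  have hbdd : Bornology.IsBounded {x | c ≤ f x} :=
    hconv.isBounded_of_addHaar_ne_top volume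
      (hconv.interior_nonempty_of_addHaar_ne_zero volume hvol)
      (hf.integrable.measure_ge_lt_top hc).ne
  have hcomp : IsCompact {x | c ≤ f x} :=
    Metric.isCompact_of_isClosed_isBounded (husc.isClosed_preimage c) hbdd
  obtain ⟨x₀, hx₀, hmax⟩ :=
    (husc.upperSemicontinuousOn _).exists_isMaxOn (nonempty_of_measure_ne_zero hvol) hcomp
  refine ⟨x₀, fun x => ?_⟩
  rcases le_total c (f x) with h | h
  · exact hmax h
  · exact h.trans hx₀
end

section
/- Let (f_n) be a sequence of log-concave densities on ℝ^d and let f be a probability density on ℝ^d such that f_n → f in distribution. Then f agrees Lebesgue-almost everywhere with a log-concave density on ℝ^d. -/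
open MeasureTheory Filter

/-- A probability density on ℝ^d (with respect to Lebesgue measure). -/
def IsDensity {d : ℕ} (f : EuclideanSpace ℝ (Fin d) → ℝ) : Prop :=
  Measurable f ∧ (∀ x, 0 ≤ f x) ∧ (∫ x, f x = 1)

/-- Convergence in distribution of a sequence of densities to a density:
the integrals against every bounded continuous function converge. -/
def TendstoInDistribution {d : ℕ} (fs : ℕ → EuclideanSpace ℝ (Fin d) → ℝ)
    (f : EuclideanSpace ℝ (Fin d) → ℝ) : Prop :=
  ∀ g : EuclideanSpace ℝ (Fin d) → ℝ, Continuous g → (∃ M, ∀ x, |g x| ≤ M) →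
    Tendsto (fun n => ∫ x, g x * fs n x) atTop (nhds (∫ x, g x * f x))

open Metric Topology Set

/-- The set of points near which `fs n` eventually attains values at least `c`. -/
def eventualSuperlevel {E : Type*} [PseudoMetricSpace E] (fs : ℕ → E → ℝ) (c : ℝ) : Set E :=
  {x | ∀ r > 0, ∀ᶠ n in atTop, ∃ z ∈ ball x r, c ≤ fs n z}

lemma eventualSuperlevel_anti {E : Type*} [PseudoMetricSpace E] (fs : ℕ → E → ℝ) {a b : ℝ}
    (hab : a ≤ b) : eventualSuperlevel fs b ⊆ eventualSuperlevel fs a := by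
  intro x hx r hr
  filter_upwards [hx r hr] with n ⟨z, hz, h⟩ using ⟨z, hz, hab.trans h⟩

lemma eventualSuperlevel_eq_univ {E : Type*} [PseudoMetricSpace E] {fs : ℕ → E → ℝ}
    (hfs : ∀ n x, 0 ≤ fs n x) {c : ℝ} (hc : c ≤ 0) : eventualSuperlevel fs c = univ := by
  refine eq_univ_of_forall fun x r hr => Eventually.of_forall fun n => ?_
  exact ⟨x, mem_ball_self hr, hc.trans (hfs n x)⟩

lemma isClosed_eventualSuperlevel {E : Type*} [PseudoMetricSpace E] (fs : ℕ → E → ℝ) (c : ℝ) :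
    IsClosed (eventualSuperlevel fs c) := by
  refine isClosed_of_closure_subset fun x hx r hr => ?_
  obtain ⟨y, hy, hxy⟩ := Metric.mem_closure_iff.1 hx (r / 2) (by positivity)
  filter_upwards [hy (r / 2) (by positivity)] with n ⟨z, hz, h⟩
  refine ⟨z, ?_, h⟩
  rw [mem_ball] at hz ⊢
  linarith [dist_triangle z y x, dist_comm x y]

/-- The defining inequality of log-concavity, for functions with nonnegative values. -/
def IsLogConcave {E : Type*} [AddCommGroup E] [Module ℝ E] (f : E → ℝ) : Prop :=
  ∀ x y : E, ∀ s t : ℝ, 0 ≤ s → 0 ≤ t → s + t = 1 → f x ^ s * f y ^ t ≤ f (s • x + t • y)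

lemma Real.rpow_mul_rpow_self_of_add_eq_one {c s t : ℝ} (hc : 0 ≤ c) (hs : 0 ≤ s) (ht : 0 ≤ t)
    (hst : s + t = 1) : c ^ s * c ^ t = c := by
  rw [← Real.rpow_add_of_nonneg hc hs ht, hst, Real.rpow_one]

lemma IsLogConcave.convex_superlevel {E : Type*} [AddCommGroup E] [Module ℝ E] {f : E → ℝ}
    (hf : IsLogConcave f) (hf0 : ∀ x, 0 ≤ f x) (c : ℝ) : Convex ℝ {x | c ≤ f x} := by
  intro x hx y hy s t hs ht hst
  rcases le_or_gt c 0 with hc | hc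
  · exact hc.trans (hf0 _)
  · calc c = c ^ s * c ^ t := (Real.rpow_mul_rpow_self_of_add_eq_one hc.le hs ht hst).symm
      _ ≤ f x ^ s * f y ^ t := by
        have hx' : c ≤ f x := hx
        have hy' : c ≤ f y := hy
        have := hf0 x
        gcongr
      _ ≤ _ := hf x y s t hs ht hst

section NormedSpace

variable {E : Type*} [NormedAddCommGroup E] [NormedSpace ℝ E] {fs : ℕ → E → ℝ}

lemma rpow_mul_rpow_mem_eventualSuperlevel (hfs : ∀ n, IsLogConcave (fs n)) {x y : E}
    {a b s t : ℝ} (ha : 0 ≤ a) (hb : 0 ≤ b) (hx : x ∈ eventualSuperlevel fs a)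
    (hy : y ∈ eventualSuperlevel fs b) (hs : 0 ≤ s) (ht : 0 ≤ t) (hst : s + t = 1) :
    s • x + t • y ∈ eventualSuperlevel fs (a ^ s * b ^ t) := by
  intro r hr
  filter_upwards [hx r hr, hy r hr] with n ⟨z, hz, h⟩ ⟨w, hw, h'⟩
  refine ⟨s • z + t • w, ?_, ?_⟩
  · have hzx : z - x ∈ ball (0 : E) r := by simpa [dist_eq_norm] using hz
    have hwy : w - y ∈ ball (0 : E) r := by simpa [dist_eq_norm] using hw
    have := convex_ball (0 : E) r hzx hwy hs ht hst
    rw [mem_ball_zero_iff] at this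
    rw [mem_ball, dist_eq_norm]
    have hEq : s • z + t • w - (s • x + t • y) = s • (z - x) + t • (w - y) := by module
    rwa [hEq]
  · refine le_trans ?_ (hfs n z w s t hs ht hst)
    have := ha.trans h
    gcongr

lemma convex_eventualSuperlevel (hfs : ∀ n, IsLogConcave (fs n)) (hfs0 : ∀ n x, 0 ≤ fs n x)
    (c : ℝ) : Convex ℝ (eventualSuperlevel fs c) := by
  rcases le_or_gt c 0 with hc | hc
  · rw [eventualSuperlevel_eq_univ hfs0 hc]
    exact convex_univ
  · intro x hx y hy s t hs ht hst
    rw [← Real.rpow_mul_rpow_self_of_add_eq_one hc.le hs ht hst]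
    exact rpow_mul_rpow_mem_eventualSuperlevel hfs hc.le hc.le hx hy hs ht hst

end NormedSpace

section InnerProductSpace

variable {E : Type*} [NormedAddCommGroup E] [InnerProductSpace ℝ E]

/-- If a convex set is `ε`-dense in a ball of radius `R`, then its closure contains the
concentric ball of radius `R - ε`. -/
lemma Convex.ball_subset_closure_of_forall_exists_dist_le [CompleteSpace E] {K : Set E}
    (hK : Convex ℝ K) {x : E} {R ε : ℝ} (hε : 0 ≤ ε)
    (h : ∀ y ∈ ball x R, ∃ k ∈ K, dist y k ≤ ε) : ball x (R - ε) ⊆ closure K := by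
  intro z hz
  by_contra hzK
  obtain ⟨f, u, hfu, huz⟩ := geometric_hahn_banach_closed_point hK.closure isClosed_closure hzK
  set a := (InnerProductSpace.toDual ℝ E).symm f with ha
  have hfa : ∀ v, f v = inner ℝ a v := fun v => by simp [ha]
  rw [mem_ball] at hz
  have key : ∀ v : E, ‖v‖ ≤ 1 → f (z + ε • v) < u + ε * ‖a‖ := by
    intro v hv
    obtain ⟨k, hk, hyk⟩ := h (z + ε • v) (by
      rw [mem_ball]
      have : dist (z + ε • v) z ≤ ε := by
        rw [dist_eq_norm, add_sub_cancel_left, norm_smul, Real.norm_of_nonneg hε]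
        nlinarith
      linarith [dist_triangle (z + ε • v) z x])
    have h1 := hfu k (subset_closure hk)
    have h2 : f (z + ε • v - k) ≤ ‖a‖ * ε := by
      rw [hfa]
      refine (real_inner_le_norm _ _).trans ?_
      rw [dist_eq_norm] at hyk
      gcongr
    rw [map_sub] at h2
    linarith
  have h3 := key (‖a‖⁻¹ • a) (by
    rw [norm_smul, norm_inv, norm_norm]
    exact inv_mul_le_one)
  have h4 : f (‖a‖⁻¹ • a) = ‖a‖ := by
    rw [map_smul, hfa, real_inner_self_eq_norm_sq, smul_eq_mul]
    rcases eq_or_ne ‖a‖ 0 with h0 | h0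
    · simp [h0]
    · field_simp
  rw [map_add, map_smul, h4, smul_eq_mul] at h3
  linarith

lemma eventually_ball_subset_closure_superlevel [FiniteDimensional ℝ E] {fs : ℕ → E → ℝ}
    (hfs : ∀ n, IsLogConcave (fs n)) (hfs0 : ∀ n x, 0 ≤ fs n x) {c R : ℝ} {x : E} (hR : 0 < R)
    (h : closedBall x R ⊆ eventualSuperlevel fs c) :
    ∀ᶠ n in atTop, ball x (R / 2) ⊆ closure {y | c ≤ fs n y} := by
  have := FiniteDimensional.proper_real E
  obtain ⟨T, hT, hTfin, hcover⟩ :=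
    (isCompact_closedBall x R).finite_cover_balls (e := R / 4) (by positivity)
  have hev : ∀ᶠ n in atTop, ∀ v ∈ T, ∃ z ∈ ball v (R / 4), c ≤ fs n z :=
    hTfin.eventually_all.2 fun v hv => h (hT hv) (R / 4) (by positivity)
  filter_upwards [hev] with n hn
  have := ((hfs n).convex_superlevel (hfs0 n) c).ball_subset_closure_of_forall_exists_dist_le
    (x := x) (R := R) (ε := R / 2) (by positivity) fun y hy => by
      obtain ⟨v, hv, hyv⟩ := mem_iUnion₂.1 (hcover (ball_subset_closedBall hy))
      obtain ⟨z, hz, hcz⟩ := hn v hv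
      refine ⟨z, hcz, ?_⟩
      rw [mem_ball] at hyv hz
      linarith [dist_triangle y v z, dist_comm v z]
  rwa [sub_half] at this

end InnerProductSpace

section Density

variable {d : ℕ} {f : EuclideanSpace ℝ (Fin d) → ℝ} {fs : ℕ → EuclideanSpace ℝ (Fin d) → ℝ}

lemma IsLogConcaveDensity.isDensity (hf : IsLogConcaveDensity f) : IsDensity f :=
  ⟨hf.1, hf.2.1, hf.2.2.1⟩

lemma IsDensity.integrable (hf : IsDensity f) : Integrable f := by
  by_contra h
  have := hf.2.2
  rw [integral_undef h] at this
  exact zero_ne_one this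

lemma IsDensity.isProbabilityMeasure (hf : IsDensity f) :
    IsProbabilityMeasure (volume.withDensity fun x => ENNReal.ofReal (f x)) := by
  constructor
  rw [withDensity_apply _ MeasurableSet.univ, Measure.restrict_univ,
    ← ofReal_integral_eq_lintegral_ofReal hf.integrable (ae_of_all _ hf.2.1), hf.2.2,
    ENNReal.ofReal_one]

lemma IsDensity.integral_withDensity (hf : IsDensity f) (g : EuclideanSpace ℝ (Fin d) → ℝ) :
    ∫ x, g x ∂(volume.withDensity fun x => ENNReal.ofReal (f x)) = ∫ x, g x * f x := by
  rw [integral_withDensity_eq_integral_toReal_smul hf.1.ennreal_ofReal (by simp)]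
  refine integral_congr_ae (ae_of_all _ fun x => ?_)
  simp [ENNReal.toReal_ofReal (hf.2.1 x), mul_comm]

lemma IsDensity.withDensity_toReal (hf : IsDensity f) {s : Set (EuclideanSpace ℝ (Fin d))}
    (hs : MeasurableSet s) :
    ((volume.withDensity fun x => ENNReal.ofReal (f x)) s).toReal = ∫ x in s, f x := by
  rw [withDensity_apply _ hs, ← ofReal_integral_eq_lintegral_ofReal hf.integrable.integrableOn
    (ae_of_all _ hf.2.1), ENNReal.toReal_ofReal (integral_nonneg hf.2.1)]

lemma TendstoInDistribution.tendsto_setAverage (hconv : TendstoInDistribution fs f)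
    (hfs : ∀ n, IsDensity (fs n)) (hf : IsDensity f) (x : EuclideanSpace ℝ (Fin d)) (r : ℝ) :
    Tendsto (fun n => ⨍ y in closedBall x r, fs n y) atTop (𝓝 (⨍ y in closedBall x r, f y)) := by
  let μ : ProbabilityMeasure (EuclideanSpace ℝ (Fin d)) := ⟨_, hf.isProbabilityMeasure⟩
  let μs : ℕ → ProbabilityMeasure (EuclideanSpace ℝ (Fin d)) :=
    fun n => ⟨_, (hfs n).isProbabilityMeasure⟩
  have hlim : Tendsto μs atTop (𝓝 μ) := by
    refine ProbabilityMeasure.tendsto_iff_forall_integral_tendsto.2 fun g => ?_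
    have := hconv g g.continuous ⟨‖g‖, fun x => g.norm_coe_le_norm x⟩
    simpa only [μ, μs, ProbabilityMeasure.coe_mk, hf.integral_withDensity,
      (hfs _).integral_withDensity] using this
  have hnull : (μ : Measure (EuclideanSpace ℝ (Fin d))) (frontier (closedBall x r)) = 0 :=
    withDensity_absolutelyContinuous _ _ ((convex_closedBall x r).addHaar_frontier volume)
  have hmeas := ProbabilityMeasure.tendsto_measure_of_null_frontier_of_tendsto' hlim hnull
  have hreal := (ENNReal.tendsto_toReal (measure_ne_top _ _)).comp hmeas
  simp only [μ, μs, ProbabilityMeasure.coe_mk, Function.comp_def,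
    hf.withDensity_toReal isClosed_closedBall.measurableSet,
    (hfs _).withDensity_toReal isClosed_closedBall.measurableSet] at hreal
  simp only [setAverage_eq]
  exact hreal.const_smul _

lemma le_setAverage_closedBall {g : EuclideanSpace ℝ (Fin d) → ℝ} (hg : Integrable g)
    {x : EuclideanSpace ℝ (Fin d)} {r c : ℝ} (hr : 0 < r)
    (h : ∀ᵐ y, y ∈ closedBall x r → c ≤ g y) : c ≤ ⨍ y in closedBall x r, g y := by
  have hpos := (measure_closedBall_pos volume x hr).ne'
  have hfin := (measure_closedBall_lt_top (μ := volume) (x := x) (r := r)).ne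
  rw [← setAverage_const hpos hfin c, setAverage_eq, setAverage_eq]
  refine smul_le_smul_of_nonneg_left ?_ (by positivity)
  exact setIntegral_mono_on_ae (integrableOn_const hfin) hg.integrableOn
    isClosed_closedBall.measurableSet h

/-- `f x` is the limit of the averages of `f` over small closed balls centred at `x`. -/
def IsAveragePoint (f : EuclideanSpace ℝ (Fin d) → ℝ) (x : EuclideanSpace ℝ (Fin d)) : Prop :=
  Tendsto (fun r => ⨍ y in closedBall x r, f y) (𝓝[>] 0) (𝓝 (f x))

lemma ae_isAveragePoint (hf : LocallyIntegrable f) : ∀ᵐ x, IsAveragePoint f x := by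
  filter_upwards [IsUnifLocDoublingMeasure.ae_tendsto_average volume hf 1] with x hx
  refine hx (fun _ => x) id tendsto_id ?_
  filter_upwards [self_mem_nhdsWithin] with r hr
  exact mem_closedBall_self (by simpa using le_of_lt hr)

lemma IsAveragePoint.le_of_mem_interior {c : ℝ} {x : EuclideanSpace ℝ (Fin d)}
    (hfx : IsAveragePoint f x) (hf : IsDensity f) (hfs : ∀ n, IsLogConcaveDensity (fs n))
    (hconv : TendstoInDistribution fs f) (hx : x ∈ interior (eventualSuperlevel fs c)) :
    c ≤ f x := by
  obtain ⟨R, hR, hball⟩ := Metric.nhds_basis_closedBall.mem_iff.1 (mem_interior_iff_mem_nhds.1 hx)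
  have hlc : ∀ n, IsLogConcave (fs n) := fun n => (hfs n).2.2.2
  have hev := eventually_ball_subset_closure_superlevel hlc (fun n => (hfs n).2.1) hR hball
  refine ge_of_tendsto hfx ?_
  filter_upwards [Ioo_mem_nhdsGT (half_pos hR)] with r hr
  refine ge_of_tendsto (hconv.tendsto_setAverage (fun n => (hfs n).isDensity) hf x r) ?_
  filter_upwards [hev] with n hn
  refine le_setAverage_closedBall (hfs n).isDensity.integrable hr.1 ?_
  have hnull := ((hlc n).convex_superlevel (hfs n).2.1 c).addHaar_frontier volume
  filter_upwards [measure_eq_zero_iff_ae_notMem.1 hnull] with y hy hyr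
  have hcl := hn (closedBall_subset_ball hr.2 hyr)
  rw [closure_eq_self_union_frontier] at hcl
  exact hcl.resolve_right hy

lemma IsAveragePoint.mem_eventualSuperlevel {c : ℝ} {x : EuclideanSpace ℝ (Fin d)}
    (hfx : IsAveragePoint f x) (hf : IsDensity f) (hfs : ∀ n, IsDensity (fs n))
    (hconv : TendstoInDistribution fs f) (hc : c < f x) : x ∈ eventualSuperlevel fs c := by
  intro r hr
  obtain ⟨ρ, hρc, hρ⟩ := ((hfx.eventually_const_lt hc).and (Ioo_mem_nhdsGT hr)).exists
  filter_upwards [(hconv.tendsto_setAverage hfs hf x ρ).eventually_const_lt hρc] with n hn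
  have hpos := (measure_closedBall_pos volume x hρ.1).ne'
  have hfin := (measure_closedBall_lt_top (μ := volume) (x := x) (r := ρ)).ne
  obtain ⟨z, hz, h⟩ := exists_setAverage_le hpos hfin (hfs n).integrable.integrableOn
  exact ⟨z, closedBall_subset_ball hρ.2 hz, hn.le.trans h⟩

lemma exists_interior_eventualSuperlevel_nonempty (hf : IsDensity f)
    (hfs : ∀ n, IsLogConcaveDensity (fs n)) (hconv : TendstoInDistribution fs f) :
    ∃ c > 0, (interior (eventualSuperlevel fs c)).Nonempty := by
  by_contra! h
  have hnull : ∀ k : ℕ, ∀ᵐ x, x ∉ eventualSuperlevel fs (1 / ((k : ℝ) + 1)) := by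
    intro k
    refine measure_eq_zero_iff_ae_notMem.1 (measure_mono_null ?_
      ((convex_eventualSuperlevel (fun n => (hfs n).2.2.2) (fun n => (hfs n).2.1)
        (1 / ((k : ℝ) + 1))).addHaar_frontier volume))
    intro x hx
    rw [frontier, h _ (by positivity), sdiff_empty]
    exact subset_closure hx
  have hf0 : f =ᵐ[volume] 0 := by
    filter_upwards [ae_all_iff.2 hnull, ae_isAveragePoint hf.integrable.locallyIntegrable]
      with x hx hfx
    refine le_antisymm (not_lt.1 fun hpos => ?_) (hf.2.1 x)
    obtain ⟨k, hk⟩ := exists_nat_one_div_lt hpos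
    exact hx k (hfx.mem_eventualSuperlevel hf (fun n => (hfs n).isDensity) hconv hk)
  have := hf.2.2
  rw [integral_congr_ae hf0] at this
  simp at this

lemma bddAbove_setOf_mem_eventualSuperlevel (hf : IsDensity f)
    (hfs : ∀ n, IsLogConcaveDensity (fs n)) (hconv : TendstoInDistribution fs f)
    (x : EuclideanSpace ℝ (Fin d)) : BddAbove {c | x ∈ eventualSuperlevel fs c} := by
  obtain ⟨c, hc, p, hp⟩ := exists_interior_eventualSuperlevel_nonempty hf hfs hconv
  let φ : EuclideanSpace ℝ (Fin d) → EuclideanSpace ℝ (Fin d) := fun z => (2 : ℝ) • z - x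
  have hφ : Continuous φ := by fun_prop
  let U := φ ⁻¹' interior (eventualSuperlevel fs c)
  have hU : IsOpen U := isOpen_interior.preimage hφ
  have hUne : U.Nonempty := ⟨(1 / 2 : ℝ) • (x + p), by
    have : φ ((1 / 2 : ℝ) • (x + p)) = p := by simp only [φ]; module
    simpa only [U, mem_preimage, this] using hp⟩
  obtain ⟨y, hyU, hy⟩ : ∃ y ∈ U, IsAveragePoint f y := by
    by_contra! h
    have hne := (hU.measure_pos volume hUne).ne'
    exact hne (measure_mono_null (fun y hy => h y hy)
      (ae_iff.1 (ae_isAveragePoint hf.integrable.locallyIntegrable)))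
  refine ⟨f y ^ 2 / c, fun M hM => ?_⟩
  rcases le_or_gt M 0 with hM0 | hM0
  · exact hM0.trans (by positivity)
  have hsub : U ⊆ eventualSuperlevel fs (M ^ (1 / 2 : ℝ) * c ^ (1 / 2 : ℝ)) := by
    intro z hz
    have := rpow_mul_rpow_mem_eventualSuperlevel (fun n => (hfs n).2.2.2) hM0.le hc.le hM
      (interior_subset hz) (by norm_num : (0 : ℝ) ≤ 1 / 2) (by norm_num : (0 : ℝ) ≤ 1 / 2)
      (by norm_num)
    have hz' : (1 / 2 : ℝ) • x + (1 / 2 : ℝ) • φ z = z := by simp only [φ]; module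
    rwa [hz'] at this
  have hle := hy.le_of_mem_interior hf hfs hconv (interior_maximal hsub hU hyU)
  rw [← Real.sqrt_eq_rpow, ← Real.sqrt_eq_rpow, ← Real.sqrt_mul hM0.le] at hle
  rw [le_div_iff₀ hc]
  exact (Real.sqrt_le_left (hf.2.1 y)).1 hle

end Density

/-- If a sequence of log-concave densities converges in distribution to a density `f`,
then `f` agrees Lebesgue-almost everywhere with a log-concave density. -/
theorem limit_in_distribution_of_logConcave_is_logConcave {d : ℕ}
    (fs : ℕ → EuclideanSpace ℝ (Fin d) → ℝ) (hfs : ∀ n, IsLogConcaveDensity (fs n))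
    (f : EuclideanSpace ℝ (Fin d) → ℝ) (hf : IsDensity f)
    (hconv : TendstoInDistribution fs f) :
    ∃ g : EuclideanSpace ℝ (Fin d) → ℝ, IsLogConcaveDensity g ∧ ∀ᵐ x, f x = g x := by
  have hfs0 : ∀ n x, 0 ≤ fs n x := fun n => (hfs n).2.1
  have hlc : ∀ n, IsLogConcave (fs n) := fun n => (hfs n).2.2.2
  have hbdd := bddAbove_setOf_mem_eventualSuperlevel hf hfs hconv
  let g : EuclideanSpace ℝ (Fin d) → ℝ := fun x => sSup {c | x ∈ eventualSuperlevel fs c}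
  have hle : ∀ {x c}, x ∈ eventualSuperlevel fs c → c ≤ g x := fun h => le_csSup (hbdd _) h
  have hzero : ∀ x, x ∈ eventualSuperlevel fs 0 := fun x => by
    simp [eventualSuperlevel_eq_univ hfs0 le_rfl]
  have hg0 : ∀ x, 0 ≤ g x := fun x => hle (hzero x)
  have hmem : ∀ {x c}, c < g x → x ∈ eventualSuperlevel fs c := fun {x c} h => by
    obtain ⟨b, hb, hcb⟩ := exists_lt_of_lt_csSup ⟨0, hzero x⟩ h
    exact eventualSuperlevel_anti fs hcb.le hb
  have hae : ∀ᵐ x, f x = g x := by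
    have hfront : ∀ q : ℚ, ∀ᵐ x, x ∉ frontier (eventualSuperlevel fs (q : ℝ)) := fun q =>
      measure_eq_zero_iff_ae_notMem.1
        ((convex_eventualSuperlevel hlc hfs0 (q : ℝ)).addHaar_frontier volume)
    filter_upwards [ae_all_iff.2 hfront, ae_isAveragePoint hf.integrable.locallyIntegrable]
      with x hx hfx
    refine le_antisymm (le_of_forall_lt fun c hc => ?_) (le_of_forall_lt fun c hc => ?_)
    · obtain ⟨b, hcb, hb⟩ := exists_between hc
      exact hcb.trans_le
        (hle (hfx.mem_eventualSuperlevel hf (fun n => (hfs n).isDensity) hconv hb))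
    · obtain ⟨q, hcq, hq⟩ := exists_rat_btwn hc
      refine hcq.trans_le (hfx.le_of_mem_interior hf hfs hconv ?_)
      have hcl := subset_closure (hmem hq)
      rw [closure_eq_interior_union_frontier] at hcl
      exact hcl.resolve_right (hx q)
  have hmeas : Measurable g := by
    refine measurable_of_Ici fun c => ?_
    have : g ⁻¹' Ici c = ⋂ b ∈ Iio c, eventualSuperlevel fs b := by
      ext x
      simp only [mem_preimage, mem_Ici, mem_iInter, mem_Iio]
      exact ⟨fun h b hb => hmem (hb.trans_le h),
        fun h => le_of_forall_lt_imp_le_of_dense fun b hb => hle (h b hb)⟩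
    rw [this]
    exact (isClosed_biInter fun b _ => isClosed_eventualSuperlevel fs b).measurableSet
  refine ⟨g, ⟨hmeas, hg0, ?_, fun x y s t hs ht hst => ?_⟩, hae⟩
  · rw [← integral_congr_ae hae, hf.2.2]
  · have hmax : ∀ (z : EuclideanSpace ℝ (Fin d)) {ε : ℝ}, 0 < ε →
        z ∈ eventualSuperlevel fs (max 0 (g z - ε)) := fun z ε hε => by
      rcases max_choice 0 (g z - ε) with h | h <;> rw [h]
      · exact hzero z
      · exact hmem (by linarith)
    have hlim : ∀ (z : EuclideanSpace ℝ (Fin d)) {p : ℝ}, 0 ≤ p →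
        Tendsto (fun ε => max 0 (g z - ε) ^ p) (𝓝[>] 0) (𝓝 (g z ^ p)) := fun z p hp => by
      have : Continuous fun ε => max 0 (g z - ε) ^ p :=
        (by fun_prop : Continuous fun ε => max 0 (g z - ε)).rpow_const fun _ => Or.inr hp
      have h := (this.tendsto 0).mono_left (nhdsWithin_le_nhds (s := Ioi 0))
      simpa [max_eq_right (hg0 z)] using h
    refine le_of_tendsto ((hlim x hs).mul (hlim y ht)) ?_
    filter_upwards [self_mem_nhdsWithin] with ε hε
    exact hle (rpow_mul_rpow_mem_eventualSuperlevel hlc (le_max_left _ _) (le_max_left _ _)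
      (hmax x hε) (hmax y hε) hs ht hst)
end

section
/- Let (f_n) be a sequence of log-concave densities on ℝ^d and let f be a continuous log-concave density on ℝ^d such that f_n → f in distribution. Let a₀ > 0 and b₀ ∈ ℝ be such that f(x) ≤ exp(−a₀‖x‖ + b₀) for all x ∈ ℝ^d. Then for every a < a₀, sup_{x ∈ ℝ^d} e^{a‖x‖} |f_n(x) − f(x)| → 0 as n → ∞. -/
open MeasureTheory Filter

/-- In a finite-dimensional inner product space, a convex set that meets every open ball of
radius `r` with center in a closed ball of radius `2 * r` contains the concentric open ball of
radius `r`. -/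
theorem Convex.ball_subset_of_forall_exists_mem_ball {E : Type*} [NormedAddCommGroup E]
    [InnerProductSpace ℝ E] [FiniteDimensional ℝ E] {C : Set E} (hC : Convex ℝ C) {x₀ : E} {r : ℝ}
    (hr : 0 < r) (h : ∀ y ∈ Metric.closedBall x₀ (2 * r), ∃ z ∈ Metric.ball y r, z ∈ C) :
    Metric.ball x₀ r ⊆ C := by
  have hcl : Metric.ball x₀ r ⊆ closure C := by
    intro x hx
    by_contra hxC
    obtain ⟨φ, u, hφ, hu⟩ := geometric_hahn_banach_closed_point hC.closure isClosed_closure hxC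
    obtain ⟨v, rfl⟩ := (InnerProductSpace.toDual ℝ E).surjective φ
    simp only [InnerProductSpace.toDual_apply_apply] at hφ hu
    have hx' : ‖x - x₀‖ < r := by rwa [Metric.mem_ball, dist_eq_norm] at hx
    have hv : 0 < ‖v‖ := by
      obtain ⟨z, -, hz⟩ := h x₀ (Metric.mem_closedBall_self (by positivity))
      have hlt := (hφ z (subset_closure hz)).trans hu
      refine norm_pos_iff.2 fun hv => ?_
      simp [hv] at hlt
    obtain ⟨z, hzb, hz⟩ := h (x + (r / ‖v‖) • v) <| by
      rw [Metric.mem_closedBall, dist_eq_norm, add_sub_right_comm]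
      calc ‖x - x₀ + (r / ‖v‖) • v‖ ≤ ‖x - x₀‖ + ‖(r / ‖v‖) • v‖ := norm_add_le _ _
        _ = ‖x - x₀‖ + r := by
          rw [norm_smul, Real.norm_of_nonneg (by positivity), div_mul_cancel₀ _ hv.ne']
        _ ≤ 2 * r := by linarith
    have hlt := (hφ z (subset_closure hz)).trans hu
    rw [Metric.mem_ball, dist_eq_norm] at hzb
    have hinner : inner ℝ v (z - (x + (r / ‖v‖) • v)) = inner ℝ v z - inner ℝ v x - r * ‖v‖ := by
      rw [inner_sub_right, inner_add_right, inner_smul_right, real_inner_self_eq_norm_sq]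
      field_simp
      ring
    have habs := (abs_le.1 (abs_real_inner_le_norm v (z - (x + (r / ‖v‖) • v)))).1
    have hmul := mul_lt_mul_of_pos_left hzb hv
    linarith
  have hspan : affineSpan ℝ C = ⊤ := by
    have hsub : closure C ⊆ affineSpan ℝ C :=
      closure_minimal (subset_affineSpan ℝ C) (AffineSubspace.closed_of_finiteDimensional _)
    rw [eq_top_iff, ← Metric.isOpen_ball.affineSpan_eq_top (Metric.nonempty_ball.2 hr)]
    exact affineSpan_le.2 (hcl.trans hsub)
  have hint := hC.interior_nonempty_iff_affineSpan_eq_top.2 hspan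
  calc Metric.ball x₀ r ⊆ interior (closure C) := interior_maximal hcl Metric.isOpen_ball
    _ = interior C := hC.interior_closure_eq_interior_of_nonempty_interior hint
    _ ⊆ C := interior_subset

section Bump

variable {d : ℕ} {fs : ℕ → EuclideanSpace ℝ (Fin d) → ℝ} {f : EuclideanSpace ℝ (Fin d) → ℝ}

/-- A continuous bump function supported in the closed ball of radius `r` around `y`. -/
noncomputable def tent {d : ℕ} (y : EuclideanSpace ℝ (Fin d)) (r : ℝ)
    (z : EuclideanSpace ℝ (Fin d)) : ℝ :=
  max 0 (r - dist z y)

theorem tent_continuous (y : EuclideanSpace ℝ (Fin d)) (r : ℝ) : Continuous (tent y r) := by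
  unfold tent
  fun_prop

theorem tent_nonneg (y : EuclideanSpace ℝ (Fin d)) (r : ℝ) (z : EuclideanSpace ℝ (Fin d)) :
    0 ≤ tent y r z :=
  le_max_left _ _

theorem tent_eq_zero {y : EuclideanSpace ℝ (Fin d)} {r : ℝ} {z : EuclideanSpace ℝ (Fin d)}
    (hz : z ∉ Metric.ball y r) : tent y r z = 0 :=
  max_eq_left (by rw [Metric.mem_ball, not_lt] at hz; linarith)

theorem abs_tent_le (y : EuclideanSpace ℝ (Fin d)) (r : ℝ) (z : EuclideanSpace ℝ (Fin d)) :
    |tent y r z| ≤ |r| := by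
  rw [abs_of_nonneg (tent_nonneg y r z)]
  exact max_le (abs_nonneg r) (by linarith [le_abs_self r, dist_nonneg (x := z) (y := y)])

theorem tent_hasCompactSupport (y : EuclideanSpace ℝ (Fin d)) (r : ℝ) :
    HasCompactSupport (tent y r) :=
  HasCompactSupport.intro (isCompact_closedBall y r) fun _ hz =>
    tent_eq_zero fun h => hz (Metric.ball_subset_closedBall h)

theorem integrable_tent_mul {g : EuclideanSpace ℝ (Fin d) → ℝ} (hg : IsLogConcaveDensity g)
    (y : EuclideanSpace ℝ (Fin d)) (r : ℝ) : Integrable fun z => tent y r z * g z :=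
  (integrable_of_integral_eq_one hg.2.2.1).bdd_mul
    (tent_continuous y r).aestronglyMeasurable (Eventually.of_forall fun z => abs_tent_le y r z)

theorem integral_tent_mul_pos {h : EuclideanSpace ℝ (Fin d) → ℝ} (hh : Continuous h)
    {y : EuclideanSpace ℝ (Fin d)} {r : ℝ} (hr : 0 < r) (hpos : ∀ z ∈ Metric.ball y r, 0 < h z) :
    0 < ∫ z, tent y r z * h z := by
  have hc : Continuous fun z => tent y r z * h z := (tent_continuous y r).mul hh
  refine hc.integral_pos_of_hasCompactSupport_nonneg_nonzero
    (tent_hasCompactSupport y r).mul_right (fun z => ?_) (x := y) ?_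
  · by_cases hz : z ∈ Metric.ball y r
    · exact mul_nonneg (tent_nonneg y r z) (hpos z hz).le
    · simp [tent_eq_zero hz]
  · exact mul_ne_zero (by simp [tent, hr.ne', hr.le]) (hpos y (Metric.mem_ball_self hr)).ne'

theorem TendstoInDistribution.eventually_exists_mem_ball_ge (hconv : TendstoInDistribution fs f)
    (hfs : ∀ n, IsLogConcaveDensity (fs n)) (hcont : Continuous f) {c r : ℝ} (hr : 0 < r)
    {y : EuclideanSpace ℝ (Fin d)} (hc : ∀ z ∈ Metric.ball y r, c < f z) :
    ∀ᶠ n in atTop, ∃ z ∈ Metric.ball y r, c ≤ fs n z := by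
  by_contra hcon
  have htc : Integrable fun z => tent y r z * c :=
    ((tent_continuous y r).integrable_of_hasCompactSupport (tent_hasCompactSupport y r)).mul_const c
  have htf : Integrable fun z => tent y r z * f z :=
    ((tent_continuous y r).mul hcont).integrable_of_hasCompactSupport
      (tent_hasCompactSupport y r).mul_right
  have hle : ∫ z, tent y r z * f z ≤ ∫ z, tent y r z * c := by
    refine le_of_tendsto_of_frequently
      (hconv _ (tent_continuous y r) ⟨|r|, abs_tent_le y r⟩) ?_
    refine (not_eventually.1 hcon).mono fun n hn => ?_
    push Not at hn
    refine integral_mono (integrable_tent_mul (hfs n) y r) htc fun z => ?_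
    by_cases hz : z ∈ Metric.ball y r
    · exact mul_le_mul_of_nonneg_left (hn z hz).le (tent_nonneg y r z)
    · simp [tent_eq_zero hz]
  have hpos := integral_tent_mul_pos (hcont.sub continuous_const) hr
    fun z hz => sub_pos.2 (hc z hz)
  simp only [Pi.sub_apply, mul_sub] at hpos
  rw [integral_sub htf htc] at hpos
  linarith

theorem TendstoInDistribution.eventually_exists_mem_ball_le (hconv : TendstoInDistribution fs f)
    (hfs : ∀ n, IsLogConcaveDensity (fs n)) (hcont : Continuous f) {c r : ℝ} (hr : 0 < r)
    {y : EuclideanSpace ℝ (Fin d)} (hc : ∀ z ∈ Metric.ball y r, f z < c) :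
    ∀ᶠ n in atTop, ∃ z ∈ Metric.ball y r, fs n z ≤ c := by
  by_contra hcon
  have htc : Integrable fun z => tent y r z * c :=
    ((tent_continuous y r).integrable_of_hasCompactSupport (tent_hasCompactSupport y r)).mul_const c
  have htf : Integrable fun z => tent y r z * f z :=
    ((tent_continuous y r).mul hcont).integrable_of_hasCompactSupport
      (tent_hasCompactSupport y r).mul_right
  have hle : ∫ z, tent y r z * c ≤ ∫ z, tent y r z * f z := by
    refine ge_of_tendsto_of_frequently
      (hconv _ (tent_continuous y r) ⟨|r|, abs_tent_le y r⟩) ?_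
    refine (not_eventually.1 hcon).mono fun n hn => ?_
    push Not at hn
    refine integral_mono htc (integrable_tent_mul (hfs n) y r) fun z => ?_
    by_cases hz : z ∈ Metric.ball y r
    · exact mul_le_mul_of_nonneg_left (hn z hz).le (tent_nonneg y r z)
    · simp [tent_eq_zero hz]
  have hpos := integral_tent_mul_pos (continuous_const.sub hcont) hr
    fun z hz => sub_pos.2 (hc z hz)
  simp only [Pi.sub_apply, mul_sub] at hpos
  rw [integral_sub htc htf] at hpos
  linarith

end Bump

theorem IsLogConcaveDensity.convex_superlevel_s7 {d : ℕ} {g : EuclideanSpace ℝ (Fin d) → ℝ}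
    (hg : IsLogConcaveDensity g) {c : ℝ} (hc : 0 < c) : Convex ℝ {x | c ≤ g x} := by
  intro x hx y hy s t hs ht hst
  calc c = c ^ s * c ^ t := by rw [← Real.rpow_add hc, hst, Real.rpow_one]
    _ ≤ g x ^ s * g y ^ t :=
      mul_le_mul (Real.rpow_le_rpow hc.le hx hs) (Real.rpow_le_rpow hc.le hy ht) (by positivity)
        (Real.rpow_nonneg (hg.2.1 x) s)
    _ ≤ g (s • x + t • y) := hg.2.2.2 x y s t hs ht hst

section LocallyUniform

variable {d : ℕ} {fs : ℕ → EuclideanSpace ℝ (Fin d) → ℝ} {f : EuclideanSpace ℝ (Fin d) → ℝ}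

theorem eventually_const_le_of_lt (hconv : TendstoInDistribution fs f)
    (hfs : ∀ n, IsLogConcaveDensity (fs n)) (hcont : Continuous f) {c : ℝ}
    {x₀ : EuclideanSpace ℝ (Fin d)} (hc : c < f x₀) :
    ∀ᶠ p : ℕ × EuclideanSpace ℝ (Fin d) in atTop ×ˢ nhds x₀, c ≤ fs p.1 p.2 := by
  rcases le_or_gt c 0 with hc0 | hc0
  · exact Eventually.of_forall fun p => hc0.trans ((hfs p.1).2.1 p.2)
  obtain ⟨R, hR, hball⟩ := Metric.eventually_nhds_iff_ball.1
    (hcont.continuousAt.eventually_const_lt hc)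
  have hmeet : ∀ᶠ p : ℕ × EuclideanSpace ℝ (Fin d) in
      atTop ×ˢ nhdsSet (Metric.closedBall x₀ (2 * (R / 4))),
      ∃ z ∈ Metric.ball p.2 (R / 4), c ≤ fs p.1 z := by
    refine (isCompact_closedBall _ _).mem_prod_nhdsSet_of_forall fun y hy => ?_
    have hev := hconv.eventually_exists_mem_ball_ge hfs hcont (c := c) (y := y)
      (r := R / 8) (by positivity) fun z hz => hball z <| by
        rw [Metric.mem_ball] at hz ⊢
        rw [Metric.mem_closedBall] at hy
        linarith [dist_triangle z y x₀]
    filter_upwards [hev.prod_mk (Metric.ball_mem_nhds y (show 0 < R / 8 by positivity))]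
    rintro ⟨n, y'⟩ ⟨⟨z, hz, hcz⟩, hy'⟩
    refine ⟨z, ?_, hcz⟩
    simp only [Metric.mem_ball] at hz hy' ⊢
    have hy'' : dist y' y < R / 8 := hy'
    linarith [dist_triangle_right z y' y]
  have hmeet' := hmeet.curry.mono fun n h => h.self_of_nhdsSet
  filter_upwards [hmeet'.prod_mk (Metric.ball_mem_nhds x₀ (show 0 < R / 4 by positivity))]
  rintro ⟨n, x⟩ ⟨hn, hx⟩
  exact ((hfs n).convex_superlevel_s7 hc0).ball_subset_of_forall_exists_mem_ball
    (by positivity) hn hx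

theorem IsLogConcaveDensity.exists_pos {g : EuclideanSpace ℝ (Fin d) → ℝ}
    (hg : IsLogConcaveDensity g) : ∃ x, 0 < g x := by
  by_contra! hcon
  have hzero : g = 0 := funext fun x => le_antisymm (hcon x) (hg.2.1 x)
  simpa [hzero] using hg.2.2.1

theorem eventually_le_const_of_lt (hconv : TendstoInDistribution fs f)
    (hfs : ∀ n, IsLogConcaveDensity (fs n)) (hf : IsLogConcaveDensity f) (hcont : Continuous f)
    {c : ℝ} {x₀ : EuclideanSpace ℝ (Fin d)} (hc : f x₀ < c) :
    ∀ᶠ p : ℕ × EuclideanSpace ℝ (Fin d) in atTop ×ˢ nhds x₀, fs p.1 p.2 ≤ c := by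
  have hc0 : 0 < c := (hf.2.1 x₀).trans_lt hc
  obtain ⟨x₁, hx₁⟩ := hf.exists_pos
  obtain ⟨c', hc', hc'c⟩ := exists_between hc
  set m := f x₁ / 2 with hm
  have hm0 : 0 < m := by positivity
  obtain ⟨R, hR, hball⟩ := Metric.eventually_nhds_iff_ball.1
    (hcont.continuousAt.eventually_lt_const hc')
  obtain ⟨P, hP, Q, hQ, hPQ⟩ := eventually_prod_iff.1
    (eventually_const_le_of_lt hconv hfs hcont (show m < f x₁ by linarith))
  obtain ⟨r₁, hr₁, hQball⟩ := Metric.eventually_nhds_iff_ball.1 hQ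
  have hs₁ : ∀ᶠ s : ℝ in nhdsWithin 0 (Set.Ioi 0), c' < c ^ (1 - s) * m ^ s := by
    have hcs : Continuous fun s : ℝ => c ^ (1 - s) * m ^ s :=
      (continuous_const.rpow (by fun_prop) fun _ => Or.inl hc0.ne').mul
        (continuous_const.rpow continuous_id fun _ => Or.inl hm0.ne')
    exact nhdsWithin_le_nhds
      ((hcs.tendsto 0).eventually_const_lt (by simpa using hc'c))
  have hs₂ : ∀ᶠ s : ℝ in nhdsWithin 0 (Set.Ioi 0),
      (1 - s) • x₀ + s • x₁ ∈ Metric.ball x₀ (R / 2) := by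
    refine nhdsWithin_le_nhds ?_
    have hcs : Continuous fun s : ℝ => (1 - s) • x₀ + s • x₁ := by fun_prop
    exact hcs.continuousAt (Metric.isOpen_ball.mem_nhds (by simpa using hR))
  have hs₃ : ∀ᶠ s : ℝ in nhdsWithin 0 (Set.Ioi 0), s < 1 :=
    nhdsWithin_le_nhds (eventually_lt_nhds one_pos)
  obtain ⟨s, ⟨⟨hsc, hsy⟩, hs1⟩, hs0⟩ :=
    (((hs₁.and hs₂).and hs₃).and (eventually_mem_nhdsWithin.mono fun _ => Set.mem_Ioi.1)).exists
  set y := (1 - s) • x₀ + s • x₁ with hy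
  have hev := hconv.eventually_exists_mem_ball_le hfs hcont (c := c') (y := y)
    (r := min (R / 2) (s * r₁ / 2)) (by positivity) fun z hz => hball z <| by
      rw [Metric.mem_ball] at hz hsy ⊢
      linarith [dist_triangle z y x₀, min_le_left (R / 2) (s * r₁ / 2)]
  filter_upwards [(hev.and hP).prod_mk
    (Metric.ball_mem_nhds x₀ (show 0 < s * r₁ / 2 by positivity))]
  rintro ⟨n, x⟩ ⟨⟨⟨z, hz, hzc⟩, hPn⟩, hx⟩
  have hx' : ‖x - x₀‖ < s * r₁ / 2 := by rw [← dist_eq_norm]; exact hx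
  have hz' : ‖z - y‖ < s * r₁ / 2 := by
    rw [← dist_eq_norm]; exact lt_of_lt_of_le hz (min_le_right _ _)
  by_contra! hcx
  set w := s⁻¹ • (z - (1 - s) • x) with hw
  have hwz : (1 - s) • x + s • w = z := by
    rw [hw, smul_inv_smul₀ hs0.ne']; abel
  have hwball : w ∈ Metric.ball x₁ r₁ := by
    have hdiff : w - x₁ = s⁻¹ • ((z - y) - (1 - s) • (x - x₀)) := by
      rw [hw, hy, ← inv_smul_smul₀ hs0.ne' x₁, ← smul_sub, smul_inv_smul₀ hs0.ne']
      congr 1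
      rw [smul_sub]; abel
    rw [Metric.mem_ball, dist_eq_norm, hdiff, norm_smul, Real.norm_of_nonneg (by positivity),
      inv_mul_lt_iff₀ hs0]
    have h1 : ‖(1 - s) • (x - x₀)‖ ≤ ‖x - x₀‖ := by
      rw [norm_smul, Real.norm_of_nonneg (by linarith)]
      exact mul_le_of_le_one_left (norm_nonneg _) (by linarith)
    linarith [norm_sub_le (z - y) ((1 - s) • (x - x₀))]
  have hmw : m ≤ fs n w := hPQ hPn (hQball w hwball)
  have hlc := (hfs n).2.2.2 x w (1 - s) s (by linarith) hs0.le (by ring)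
  rw [hwz] at hlc
  have hmono : c ^ (1 - s) * m ^ s ≤ fs n x ^ (1 - s) * fs n w ^ s :=
    mul_le_mul (Real.rpow_le_rpow hc0.le hcx.le (by linarith))
      (Real.rpow_le_rpow hm0.le hmw hs0.le) (by positivity)
      (Real.rpow_nonneg ((hfs n).2.1 x) _)
  linarith

theorem eventually_forall_abs_sub_le_of_isCompact (hconv : TendstoInDistribution fs f)
    (hfs : ∀ n, IsLogConcaveDensity (fs n)) (hf : IsLogConcaveDensity f) (hcont : Continuous f)
    {K : Set (EuclideanSpace ℝ (Fin d))} (hK : IsCompact K) {ε : ℝ} (hε : 0 < ε) :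
    ∀ᶠ n in atTop, ∀ x ∈ K, |fs n x - f x| ≤ ε := by
  have hprod : ∀ᶠ p : ℕ × EuclideanSpace ℝ (Fin d) in atTop ×ˢ nhdsSet K,
      |fs p.1 p.2 - f p.2| ≤ ε := by
    refine hK.mem_prod_nhdsSet_of_forall fun y _ => ?_
    have hy : ∀ᶠ p : ℕ × EuclideanSpace ℝ (Fin d) in atTop ×ˢ nhds y,
        dist (f p.2) (f y) < ε / 2 :=
      tendsto_snd.eventually (hcont.continuousAt.eventually (Metric.ball_mem_nhds _ (half_pos hε)))
    filter_upwards [hy, eventually_const_le_of_lt hconv hfs hcont (show f y - ε / 2 < f y by linarith),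
      eventually_le_const_of_lt hconv hfs hf hcont (show f y < f y + ε / 2 by linarith)] with p h1 h2 h3
    rw [Real.dist_eq, abs_lt] at h1
    exact abs_le.2 ⟨by linarith, by linarith⟩
  exact hprod.curry.mono fun n h => h.self_of_nhdsSet

end LocallyUniform

/-- A log-concave function that drops by the factor `exp (-b * R)` from a point to the sphere of
radius `R` around it decays at exponential rate `b` outside that sphere. -/
theorem IsLogConcaveDensity.le_exp_of_le_sphere {d : ℕ} {g : EuclideanSpace ℝ (Fin d) → ℝ}
    (hg : IsLogConcaveDensity g) {m b R : ℝ} (hm : 0 < m) (hR : 0 < R)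
    {x₁ : EuclideanSpace ℝ (Fin d)} (hx₁ : m ≤ g x₁)
    (hsphere : ∀ z ∈ Metric.sphere x₁ R, g z ≤ m * Real.exp (-b * R))
    {x : EuclideanSpace ℝ (Fin d)} (hx : R ≤ ‖x - x₁‖) :
    g x ≤ m * Real.exp (-b * ‖x - x₁‖) := by
  have hρ : 0 < ‖x - x₁‖ := hR.trans_le hx
  set s := R / ‖x - x₁‖ with hs
  have hs0 : 0 < s := by positivity
  have hs1 : s ≤ 1 := (div_le_one hρ).2 hx
  have hz : (1 - s) • x₁ + s • x ∈ Metric.sphere x₁ R := by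
    have hdiff : (1 - s) • x₁ + s • x - x₁ = s • (x - x₁) := by module
    rw [mem_sphere_iff_norm, hdiff, norm_smul, Real.norm_of_nonneg hs0.le, hs,
      div_mul_cancel₀ _ hρ.ne']
  have hlc := (hg.2.2.2 x₁ x (1 - s) s (by linarith) hs0.le (by ring)).trans (hsphere _ hz)
  have hle : m ^ (1 - s) * g x ^ s ≤ m ^ (1 - s) * (m * Real.exp (-b * ‖x - x₁‖)) ^ s := by
    calc m ^ (1 - s) * g x ^ s ≤ g x₁ ^ (1 - s) * g x ^ s :=
          mul_le_mul_of_nonneg_right (Real.rpow_le_rpow hm.le hx₁ (by linarith))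
            (Real.rpow_nonneg (hg.2.1 x) _)
      _ ≤ m * Real.exp (-b * R) := hlc
      _ = m ^ (1 - s) * (m * Real.exp (-b * ‖x - x₁‖)) ^ s := by
        rw [Real.mul_rpow hm.le (Real.exp_nonneg _), ← mul_assoc, ← Real.rpow_add hm,
          sub_add_cancel, Real.rpow_one, ← Real.exp_mul, mul_assoc, hs, mul_div_cancel₀ _ hρ.ne']
  exact (Real.rpow_le_rpow_iff (hg.2.1 x) (by positivity) hs0).1
    (le_of_mul_le_mul_left hle (by positivity))

theorem exists_eventually_le_mul_exp {d : ℕ} {fs : ℕ → EuclideanSpace ℝ (Fin d) → ℝ}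
    {f : EuclideanSpace ℝ (Fin d) → ℝ} (hconv : TendstoInDistribution fs f)
    (hfs : ∀ n, IsLogConcaveDensity (fs n)) (hf : IsLogConcaveDensity f) (hcont : Continuous f)
    {a₀ b₀ : ℝ} (ha₀ : 0 < a₀) (hbound : ∀ x, f x ≤ Real.exp (-a₀ * ‖x‖ + b₀)) {b : ℝ}
    (hb0 : 0 ≤ b) (hb : b < a₀) :
    ∃ C R : ℝ, ∀ᶠ n in atTop, ∀ x, R ≤ ‖x‖ → fs n x ≤ C * Real.exp (-b * ‖x‖) := by
  obtain ⟨x₁, hx₁⟩ := hf.exists_pos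
  set m := f x₁ / 2 with hm
  have hm0 : 0 < m := by positivity
  obtain ⟨R, hRm, hR⟩ : ∃ R : ℝ,
      Real.exp (a₀ * ‖x₁‖ + b₀) * Real.exp (-((a₀ - b) * R)) < m / 2 ∧ 0 < R := by
    have hlim : Tendsto (fun R : ℝ => Real.exp (a₀ * ‖x₁‖ + b₀) * Real.exp (-((a₀ - b) * R)))
        atTop (nhds (Real.exp (a₀ * ‖x₁‖ + b₀) * 0)) :=
      (Real.tendsto_exp_neg_atTop_nhds_zero.comp
        (tendsto_id.const_mul_atTop (sub_pos.2 hb))).const_mul _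
    rw [mul_zero] at hlim
    exact ((hlim.eventually_lt_const (half_pos hm0)).and (eventually_gt_atTop 0)).exists
  have hfsphere : ∀ z ∈ Metric.sphere x₁ R, f z ≤ m / 2 * Real.exp (-b * R) := by
    intro z hz
    rw [mem_sphere_iff_norm] at hz
    have hnorm : R - ‖x₁‖ ≤ ‖z‖ := by linarith [norm_sub_le z x₁]
    calc f z ≤ Real.exp (-a₀ * ‖z‖ + b₀) := hbound z
      _ ≤ Real.exp (-a₀ * (R - ‖x₁‖) + b₀) :=
        Real.exp_le_exp.2 (by nlinarith [mul_le_mul_of_nonneg_left hnorm ha₀.le])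
      _ = Real.exp (a₀ * ‖x₁‖ + b₀) * Real.exp (-((a₀ - b) * R)) * Real.exp (-b * R) := by
        rw [← Real.exp_add, ← Real.exp_add]
        ring_nf
      _ ≤ m / 2 * Real.exp (-b * R) := by gcongr
  refine ⟨m * Real.exp (b * ‖x₁‖), R + ‖x₁‖, ?_⟩
  filter_upwards [eventually_forall_abs_sub_le_of_isCompact hconv hfs hf hcont (isCompact_sphere x₁ R)
      (show 0 < m / 2 * Real.exp (-b * R) by positivity),
    eventually_forall_abs_sub_le_of_isCompact hconv hfs hf hcont (isCompact_singleton (x := x₁)) hm0]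
    with n hn hn₁ x hx
  have hsphere : ∀ z ∈ Metric.sphere x₁ R, fs n z ≤ m * Real.exp (-b * R) := fun z hz => by
    linarith [(abs_le.1 (hn z hz)).2, hfsphere z hz]
  have hmx : m ≤ fs n x₁ := by linarith [(abs_le.1 (hn₁ x₁ rfl)).1]
  have hxn : ‖x‖ ≤ ‖x - x₁‖ + ‖x₁‖ := by simpa using norm_add_le (x - x₁) x₁
  calc fs n x ≤ m * Real.exp (-b * ‖x - x₁‖) :=
        (hfs n).le_exp_of_le_sphere hm0 hR hmx hsphere (by linarith)
    _ ≤ m * Real.exp (b * ‖x₁‖ + -b * ‖x‖) := by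
      gcongr
      nlinarith [mul_le_mul_of_nonneg_left hxn hb0]
    _ = m * Real.exp (b * ‖x₁‖) * Real.exp (-b * ‖x‖) := by rw [Real.exp_add, mul_assoc]

/-- If a sequence of log-concave densities converges in distribution to a continuous
log-concave density `f` with `f x ≤ exp (−a₀‖x‖ + b₀)`, then for every `a < a₀` the
exponentially weighted supremum distance `sup_x exp (a‖x‖) |fₙ x − f x|` tends to `0`
(stated explicitly in ε–N form, since the weighted differences are nonnegative). -/
theorem logConcave_tendstoInDistribution_weighted_sup {d : ℕ}
    (fs : ℕ → EuclideanSpace ℝ (Fin d) → ℝ) (hfs : ∀ n, IsLogConcaveDensity (fs n))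
    (f : EuclideanSpace ℝ (Fin d) → ℝ) (hf : IsLogConcaveDensity f) (hcont : Continuous f)
    (hconv : TendstoInDistribution fs f)
    (a₀ : ℝ) (ha₀ : 0 < a₀) (b₀ : ℝ) (hbound : ∀ x, f x ≤ Real.exp (-a₀ * ‖x‖ + b₀))
    (a : ℝ) (ha : a < a₀) :
    ∀ ε > (0 : ℝ), ∃ N : ℕ, ∀ n ≥ N, ∀ x, Real.exp (a * ‖x‖) * |fs n x - f x| ≤ ε := by
  intro ε hε
  obtain ⟨b, hmax, hb⟩ := exists_between (max_lt ha ha₀)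
  have hab : a < b := (le_max_left a 0).trans_lt hmax
  have hb0 : 0 < b := (le_max_right a 0).trans_lt hmax
  obtain ⟨C, R₁, htail⟩ := exists_eventually_le_mul_exp hconv hfs hf hcont ha₀ hbound hb0.le hb
  have hlim : Tendsto (fun t : ℝ => max C (Real.exp b₀) * Real.exp (-((b - a) * t)))
      atTop (nhds (max C (Real.exp b₀) * 0)) :=
    (Real.tendsto_exp_neg_atTop_nhds_zero.comp
      (tendsto_id.const_mul_atTop (sub_pos.2 hab))).const_mul _
  rw [mul_zero] at hlim
  obtain ⟨R, hR⟩ := eventually_atTop.1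
    ((hlim.eventually_lt_const hε).and (eventually_ge_atTop R₁))
  obtain ⟨N, hN⟩ := eventually_atTop.1 <| htail.and <|
    eventually_forall_abs_sub_le_of_isCompact hconv hfs hf hcont
      (isCompact_closedBall (0 : EuclideanSpace ℝ (Fin d)) R)
      (show 0 < ε * Real.exp (-(|a| * R)) by positivity)
  refine ⟨N, fun n hn x => ?_⟩
  obtain ⟨hn₁, hn₂⟩ := hN n hn
  rcases le_total ‖x‖ R with hx | hx
  · calc Real.exp (a * ‖x‖) * |fs n x - f x|
        ≤ Real.exp (|a| * R) * (ε * Real.exp (-(|a| * R))) := by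
          gcongr
          · exact le_abs_self a
          · exact hn₂ x (mem_closedBall_zero_iff.2 hx)
      _ = ε := by rw [mul_left_comm, ← Real.exp_add, add_neg_cancel, Real.exp_zero, mul_one]
  · obtain ⟨hRx, hR₁x⟩ := hR ‖x‖ hx
    have hfsx : fs n x ≤ max C (Real.exp b₀) * Real.exp (-b * ‖x‖) :=
      (hn₁ x hR₁x).trans (by gcongr; exact le_max_left _ _)
    have hfx : f x ≤ max C (Real.exp b₀) * Real.exp (-b * ‖x‖) :=
      calc f x ≤ Real.exp (-a₀ * ‖x‖ + b₀) := hbound x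
        _ ≤ Real.exp (b₀ + -b * ‖x‖) :=
          Real.exp_le_exp.2 (by nlinarith [mul_le_mul_of_nonneg_right hb.le (norm_nonneg x)])
        _ = Real.exp b₀ * Real.exp (-b * ‖x‖) := Real.exp_add _ _
        _ ≤ _ := by gcongr; exact le_max_right _ _
    have habs : |fs n x - f x| ≤ max C (Real.exp b₀) * Real.exp (-b * ‖x‖) :=
      abs_sub_le_of_nonneg_of_le ((hfs n).2.1 x) hfsx (hf.2.1 x) hfx
    calc Real.exp (a * ‖x‖) * |fs n x - f x|
        ≤ Real.exp (a * ‖x‖) * (max C (Real.exp b₀) * Real.exp (-b * ‖x‖)) := by gcongr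
      _ = max C (Real.exp b₀) * Real.exp (-((b - a) * ‖x‖)) := by
        rw [mul_left_comm, ← Real.exp_add]
        ring_nf
      _ ≤ ε := hRx.le
end

section
/- Let (f_n) be a sequence of log-concave densities on ℝ^d and let f be a log-concave density on ℝ^d such that f_n → f in distribution. Let a₀ > 0 and b₀ ∈ ℝ be such that f(x) ≤ exp(−a₀‖x‖ + b₀) for all x ∈ ℝ^d. Then for every a < a₀ there exist b ∈ ℝ and n₀ ∈ ℕ such that f_n(x) ≤ exp(−a‖x‖ + b) for all n ≥ n₀ and all x ∈ ℝ^d. -/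
open MeasureTheory Filter

open Set Topology

section Envelope

variable {d : ℕ}

local notation "E" => EuclideanSpace ℝ (Fin d)

theorem IsLogConcaveDensity.integrable_s8 {h : E → ℝ} (hh : IsLogConcaveDensity h) :
    Integrable h :=
  integrable_of_integral_eq_one hh.2.2.1

theorem IsLogConcaveDensity.convex_superlevel_s8 {h : E → ℝ} (hh : IsLogConcaveDensity h)
    {c : ℝ} (hc : 0 < c) : Convex ℝ {x | c ≤ h x} := by
  intro x hx y hy s t hs ht hst
  have hx' : c ≤ h x := hx
  have hy' : c ≤ h y := hy
  have hx0 := hh.2.1 x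
  calc c = c ^ s * c ^ t := by rw [← Real.rpow_add hc, hst, Real.rpow_one]
    _ ≤ h x ^ s * h y ^ t := by gcongr
    _ ≤ h (s • x + t • y) := hh.2.2.2 x y s t hs ht hst

theorem IsLogConcaveDensity.convex_pos {h : E → ℝ} (hh : IsLogConcaveDensity h) :
    Convex ℝ {x | 0 < h x} := by
  intro x hx y hy s t hs ht hst
  exact (mul_pos (Real.rpow_pos_of_pos hx s) (Real.rpow_pos_of_pos hy t)).trans_le
    (hh.2.2.2 x y s t hs ht hst)

/-- A log-concave density is positive on some ball. -/
theorem IsLogConcaveDensity.exists_ball_pos {h : E → ℝ} (hh : IsLogConcaveDensity h) :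
    ∃ x : E, ∃ r > 0, ∀ y ∈ Metric.ball x r, 0 < h y := by
  have hne : (interior {x | 0 < h x}).Nonempty := by
    by_contra hemp
    rw [Set.not_nonempty_iff_eq_empty] at hemp
    have h0 : volume {x | 0 < h x} = 0 := by
      refine measure_mono_null ?_ (hh.convex_pos.addHaar_frontier volume)
      intro x hx
      rw [frontier, hemp, Set.sdiff_empty]
      exact subset_closure hx
    have hae : h =ᵐ[volume] 0 := by
      rw [Filter.EventuallyEq, ae_iff]
      refine measure_mono_null ?_ h0
      intro x hx
      exact lt_of_le_of_ne (hh.2.1 x) (Ne.symm hx)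
    have := hh.2.2.1
    rw [integral_congr_ae hae] at this
    simp at this
  obtain ⟨x, hx⟩ := hne
  obtain ⟨r, hr, hsub⟩ := Metric.isOpen_iff.1 isOpen_interior x hx
  exact ⟨x, r, hr, fun y hy => interior_subset (s := {x | 0 < h x}) (hsub hy)⟩

/-- Integrals of a function dominated along the contraction of ratio `s` towards a point. -/
theorem pow_mul_integral_le_of_le_comp {s : ℝ} (hs : 0 < s) (v : E) {φ G : E → ℝ}
    (hφ : ∀ y, 0 ≤ φ y) (hG : Integrable G) (hle : ∀ y, φ y ≤ G (s • y + v)) :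
    s ^ d * ∫ y, φ y ≤ ∫ z, G z := by
  have h1 : ∫ y, φ y ≤ ∫ y, G (s • y + v) := by
    refine integral_mono_of_nonneg (Eventually.of_forall hφ) ?_ (Eventually.of_forall hle)
    exact (hG.comp_add_right v).comp_smul hs.ne'
  have h2 : ∫ y, G (s • y + v) = (s ^ d)⁻¹ * ∫ z, G z := by
    rw [Measure.integral_comp_smul volume (fun y : E => G (y + v)) s,
      integral_add_right_eq_self, finrank_euclideanSpace_fin, smul_eq_mul,
      abs_of_pos (by positivity)]
  calc s ^ d * ∫ y, φ y ≤ s ^ d * ((s ^ d)⁻¹ * ∫ z, G z) := by rw [← h2]; gcongr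
    _ = ∫ z, G z := by field_simp

theorem integrable_exp_neg_mul_norm {ε : ℝ} (hε : 0 < ε) :
    Integrable (fun x : E => Real.exp (-ε * ‖x‖)) := by
  have hJ : Integrable (fun x : E => (1 + ‖x‖) ^ (-((d + 1 : ℕ) : ℝ))) :=
    integrable_one_add_norm (by simp)
  refine (hJ.const_mul (Real.exp ε * (d + 1).factorial / ε ^ (d + 1))).mono'
    (by fun_prop) (Eventually.of_forall fun x => ?_)
  have hpos : 0 < 1 + ‖x‖ := by positivity
  have h1 := Real.pow_div_factorial_le_exp (ε * (1 + ‖x‖)) (by positivity) (d + 1)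
  rw [Real.norm_of_nonneg (Real.exp_pos _).le, Real.rpow_neg hpos.le, Real.rpow_natCast,
    neg_mul, Real.exp_neg]
  rw [mul_add, mul_one, Real.exp_add, div_le_iff₀ (by positivity), ← mul_one_add, mul_pow] at h1
  rw [inv_le_iff_one_le_mul₀ (by positivity)]
  field_simp
  rw [mul_comm ‖x‖ ε]
  linarith

/-- A continuous cutoff vanishing on the ball of radius `M - 1` and equal to one off the ball
of radius `M`. -/
noncomputable def radialCutoff (M : ℝ) (x : E) : ℝ := min 1 (max 0 (‖x‖ - M + 1))

theorem continuous_radialCutoff (M : ℝ) : Continuous (radialCutoff M : E → ℝ) := by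
  unfold radialCutoff
  fun_prop

theorem radialCutoff_nonneg (M : ℝ) (x : E) : 0 ≤ radialCutoff M x := by
  simp [radialCutoff]

theorem radialCutoff_le_one (M : ℝ) (x : E) : radialCutoff M x ≤ 1 := by
  simp [radialCutoff]

theorem abs_radialCutoff_le_one (M : ℝ) (x : E) : |radialCutoff M x| ≤ 1 := by
  rw [abs_of_nonneg (radialCutoff_nonneg M x)]
  exact radialCutoff_le_one M x

theorem radialCutoff_eq_one {M : ℝ} {x : E} (hx : M ≤ ‖x‖) : radialCutoff M x = 1 := by
  rw [radialCutoff, min_eq_left]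
  exact le_max_of_le_right (by linarith)

theorem radialCutoff_eq_zero {M : ℝ} {x : E} (hx : ‖x‖ ≤ M - 1) : radialCutoff M x = 0 := by
  rw [radialCutoff, max_eq_left (by linarith), min_eq_right zero_le_one]

theorem IsLogConcaveDensity.integrable_radialCutoff_mul {h : E → ℝ}
    (hh : IsLogConcaveDensity h) (M : ℝ) : Integrable (fun x => radialCutoff M x * h x) :=
  hh.integrable_s8.bdd_mul (c := 1) (continuous_radialCutoff M).aestronglyMeasurable
    (Eventually.of_forall fun x => by
      rw [Real.norm_eq_abs]
      exact abs_radialCutoff_le_one M x)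

/-- The tail mass of a function with an exponential envelope decays exponentially. -/
theorem exists_integral_radialCutoff_mul_lt {f : E → ℝ} (hf0 : ∀ x, 0 ≤ f x) {a₀ b₀ : ℝ}
    (hbound : ∀ x, f x ≤ Real.exp (-a₀ * ‖x‖ + b₀)) {a : ℝ} (ha : 0 < a) (haa : a < a₀) :
    ∃ C > 0, ∀ M, ∫ x, radialCutoff M x * f x < C * Real.exp (-a * M) := by
  have hI := integrable_exp_neg_mul_norm (d := d) (sub_pos.2 haa)
  have hI0 : 0 ≤ ∫ x : E, Real.exp (-(a₀ - a) * ‖x‖) :=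
    integral_nonneg fun x => (Real.exp_pos _).le
  refine ⟨Real.exp (a + b₀) * (∫ x : E, Real.exp (-(a₀ - a) * ‖x‖)) + 1, by positivity,
    fun M => ?_⟩
  have hle : ∫ x, radialCutoff M x * f x ≤
      ∫ x : E, Real.exp (-a * M) * Real.exp (a + b₀) * Real.exp (-(a₀ - a) * ‖x‖) := by
    refine integral_mono_of_nonneg
      (Eventually.of_forall fun x => mul_nonneg (radialCutoff_nonneg M x) (hf0 x))
      (hI.const_mul _) (Eventually.of_forall fun x => ?_)
    dsimp only
    rcases le_total ‖x‖ (M - 1) with hx | hx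
    · rw [radialCutoff_eq_zero hx, zero_mul]
      positivity
    · calc radialCutoff M x * f x ≤ 1 * Real.exp (-a₀ * ‖x‖ + b₀) :=
            mul_le_mul (radialCutoff_le_one M x) (hbound x) (hf0 x) zero_le_one
        _ ≤ Real.exp (-a * M) * Real.exp (a + b₀) * Real.exp (-(a₀ - a) * ‖x‖) := by
            rw [one_mul, ← Real.exp_add, ← Real.exp_add, Real.exp_le_exp]
            nlinarith
  rw [integral_const_mul] at hle
  have := Real.exp_pos (-a * M)
  nlinarith

/-- Mass of the limit near a point forces eventual lower bounds at nearby points. -/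
theorem eventually_exists_le_of_tendstoInDistribution {fs : ℕ → E → ℝ}
    (hfs : ∀ n, IsLogConcaveDensity (fs n)) {f : E → ℝ} (hf : IsLogConcaveDensity f)
    (hconv : TendstoInDistribution fs f) {p : E} {η : ℝ} (hη : 0 < η)
    (hpos : ∀ y ∈ Metric.ball p η, 0 < f y) :
    ∀ᶠ c in 𝓝[>] (0 : ℝ), ∀ᶠ n in atTop, ∃ y ∈ Metric.ball p η, c ≤ fs n y := by
  set g : E → ℝ := fun z => max 0 (η - dist z p) with hg
  have hgc : Continuous g := by fun_prop
  have hg0 : ∀ z, 0 ≤ g z := fun z => le_max_left _ _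
  have hgη : ∀ z, |g z| ≤ η := fun z => by
    rw [abs_of_nonneg (hg0 z)]
    exact max_le hη.le (by linarith [dist_nonneg (x := z) (y := p)])
  have hgout : ∀ z, z ∉ Metric.ball p η → g z = 0 := fun z hz =>
    max_eq_left (by rw [Metric.mem_ball, not_lt] at hz; linarith)
  have hgI : Integrable g := by
    refine hgc.integrable_of_hasCompactSupport ?_
    refine HasCompactSupport.intro (isCompact_closedBall p η) fun z hz => hgout z ?_
    exact fun h => hz (Metric.ball_subset_closedBall h)
  have hgfI : Integrable (fun z => g z * f z) :=
    hf.integrable_s8.bdd_mul (c := η) hgc.aestronglyMeasurable (Eventually.of_forall hgη)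
  have hm : 0 < ∫ z, g z * f z := by
    rw [integral_pos_iff_support_of_nonneg (fun z => mul_nonneg (hg0 z) (hf.2.1 z)) hgfI]
    refine (Metric.measure_ball_pos volume p hη).trans_le (measure_mono fun z hz => ?_)
    rw [Function.mem_support]
    have : 0 < g z := lt_max_of_lt_right (by rw [Metric.mem_ball] at hz; linarith)
    exact (mul_pos this (hpos z hz)).ne'
  have hc : Tendsto (fun c : ℝ => c * ∫ z, g z) (𝓝[>] 0) (𝓝 0) := by
    have : Tendsto (fun c : ℝ => c * ∫ z, g z) (𝓝 0) (𝓝 (0 * ∫ z, g z)) :=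
      tendsto_id.mul_const _
    rw [zero_mul] at this
    exact this.mono_left nhdsWithin_le_nhds
  filter_upwards [hc.eventually_lt_const (half_pos hm)] with c hcm
  filter_upwards [(hconv g hgc ⟨η, hgη⟩).eventually_const_lt (half_lt_self hm)] with n hn
  by_contra! hlt
  have : ∫ z, g z * fs n z ≤ ∫ z, c * g z := by
    refine integral_mono_of_nonneg
      (Eventually.of_forall fun z => mul_nonneg (hg0 z) ((hfs n).2.1 z))
      (hgI.const_mul c) (Eventually.of_forall fun z => ?_)
    dsimp only
    by_cases hz : z ∈ Metric.ball p η
    · nlinarith [hlt z hz, hg0 z]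
    · simp [hgout z hz]
  rw [integral_const_mul] at this
  linarith

/-- The vertices of a cross-polytope of radius `δ` centred at `x`, together with `x`. -/
noncomputable def crossPolytopePoint (x : E) (δ : ℝ) : Option (Fin d × Bool) → E
  | none => x
  | some (i, b) => x + (if b then δ else -δ) • EuclideanSpace.single i (1 : ℝ)

theorem dist_crossPolytopePoint_le (x : E) {δ : ℝ} (hδ : 0 < δ) (i : Option (Fin d × Bool)) :
    dist (crossPolytopePoint x δ i) x ≤ δ := by
  rcases i with _ | ⟨i, b⟩
  · simpa [crossPolytopePoint] using hδ.le
  · cases b <;> simp [crossPolytopePoint, dist_eq_norm, norm_smul, abs_of_pos hδ]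

/-- A convex set meeting small balls around the points of a cross-polytope contains a ball
around its centre. -/
theorem ball_subset_of_crossPolytope {A : Set E} (hA : Convex ℝ A) (x : E) {δ : ℝ}
    (hδ : 0 < δ) (hmeet : ∀ i, ∃ y ∈ Metric.ball (crossPolytopePoint x δ i)
      (δ / (4 * (d + 1))), y ∈ A) :
    Metric.ball x (δ / (4 * (d + 1))) ⊆ A := by
  choose y hyb hyA using hmeet
  set η := δ / (4 * ((d : ℝ) + 1)) with hη
  intro z hz
  have hsub : convexHull ℝ (range y) ⊆ A := convexHull_min (range_subset_iff.2 hyA) hA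
  refine hsub ?_
  by_contra hzn
  obtain ⟨u, c, huz, hu⟩ := geometric_hahn_banach_point_closed (convex_convexHull ℝ (range y))
    ((finite_range y).isClosed_convexHull (𝕜 := ℝ)) hzn
  have hlt : ∀ i, u z < u (y i) := fun i =>
    huz.trans (hu _ (subset_convexHull ℝ _ (mem_range_self i)))
  have hest : ∀ v w : E, v ∈ Metric.ball w η → |u v - u w| ≤ ‖u‖ * η := fun v w hv => by
    rw [← map_sub, ← Real.norm_eq_abs]
    refine (u.le_opNorm _).trans ?_
    rw [Metric.mem_ball, dist_eq_norm] at hv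
    gcongr
  have hcoord : ∀ i, |u (EuclideanSpace.single i 1)| * δ ≤ 2 * (‖u‖ * η) := fun i => by
    have h1 := hlt (some (i, true))
    have h2 := hlt (some (i, false))
    have e1 := abs_le.1 (hest _ _ (hyb (some (i, true))))
    have e2 := abs_le.1 (hest _ _ (hyb (some (i, false))))
    have e0 := abs_le.1 (hest _ _ hz)
    simp only [crossPolytopePoint, map_add, map_smul, smul_eq_mul, if_true, Bool.false_eq_true,
      if_false] at e1 e2
    rw [show |u (EuclideanSpace.single i 1)| * δ = |u (EuclideanSpace.single i 1) * δ| by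
      rw [abs_mul, abs_of_pos hδ], abs_le]
    constructor <;> linarith
  have hbd : ∀ v : E, ‖u v‖ ≤ (d * (2 * (‖u‖ * η) / δ)) * ‖v‖ := fun v => by
    have hv : v = ∑ i, v i • EuclideanSpace.single i (1 : ℝ) := by
      ext j
      simp [Finset.sum_apply, Pi.single_apply]
    calc ‖u v‖ = ‖∑ i, v i * u (EuclideanSpace.single i (1 : ℝ))‖ := by
          conv_lhs => rw [hv]
          simp only [map_sum, map_smul, smul_eq_mul]
      _ ≤ ∑ i : Fin d, (2 * (‖u‖ * η) / δ) * ‖v‖ := by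
          refine norm_sum_le_of_le _ fun i _ => ?_
          rw [norm_mul, mul_comm]
          refine mul_le_mul ?_ (PiLp.norm_apply_le v i) (norm_nonneg _) (by positivity)
          rw [le_div_iff₀ hδ, Real.norm_eq_abs]
          exact hcoord i
      _ = (d * (2 * (‖u‖ * η) / δ)) * ‖v‖ := by simp; ring
  have hnorm := u.opNorm_le_bound (by positivity) hbd
  have heq : (d : ℝ) * (2 * (‖u‖ * η) / δ) = ‖u‖ * (d / (2 * (d + 1))) := by
    rw [hη]; field_simp; ring
  have hfrac : (d : ℝ) / (2 * (d + 1)) ≤ 1 / 2 := by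
    rw [div_le_div_iff₀ (by positivity) (by positivity)]; linarith
  have hu0 : ‖u‖ = 0 := by nlinarith [norm_nonneg u]
  have := hlt none
  rw [norm_eq_zero.1 hu0] at this
  simp at this

/-- A log-concave density bounded below on a ball is bounded above. -/
theorem IsLogConcaveDensity.le_of_ball_le {h : E → ℝ} (hh : IsLogConcaveDensity h) {x : E}
    {r c : ℝ} (hr : 0 < r) (hc : 0 < c) (hball : ∀ y ∈ Metric.ball x r, c ≤ h y) (z : E) :
    h z ≤ (2 ^ d / (√c * volume.real (Metric.ball x r))) ^ 2 := by
  have hvol : 0 < volume.real (Metric.ball x r) :=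
    ENNReal.toReal_pos (Metric.measure_ball_pos volume x hr).ne' measure_ball_lt_top.ne
  have hint := pow_mul_integral_le_of_le_comp (s := 1 / 2) (by norm_num) ((1 / 2 : ℝ) • z)
    (φ := (Metric.ball x r).indicator fun _ => √c * √(h z)) (G := h)
    (fun y => indicator_nonneg (fun _ _ => by positivity) y) hh.integrable_s8
    (fun y => by
      by_cases hy : y ∈ Metric.ball x r
      · rw [indicator_of_mem hy]
        have := hh.2.2.2 y z (1 / 2) (1 / 2) (by norm_num) (by norm_num) (by norm_num)
        rw [← Real.sqrt_eq_rpow, ← Real.sqrt_eq_rpow] at this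
        refine le_trans ?_ this
        gcongr
        exact hball y hy
      · rw [indicator_of_notMem hy]
        exact hh.2.1 _)
  rw [hh.2.2.1, integral_indicator_const _ measurableSet_ball, smul_eq_mul] at hint
  have hsc : 0 < √c := Real.sqrt_pos.2 hc
  rw [← Real.sqrt_le_left (by positivity), le_div_iff₀ (by positivity)]
  rw [one_div, inv_pow, inv_mul_le_iff₀ (by positivity)] at hint
  linarith

theorem exists_eventually_le_of_tendstoInDistribution {fs : ℕ → E → ℝ}
    (hfs : ∀ n, IsLogConcaveDensity (fs n)) {f : E → ℝ} (hf : IsLogConcaveDensity f)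
    (hconv : TendstoInDistribution fs f) :
    ∃ S > 0, ∀ᶠ n in atTop, ∀ x, fs n x ≤ S := by
  obtain ⟨x, r, hr, hpos⟩ := hf.exists_ball_pos
  set δ := r / 2 with hδ
  have hδ0 : 0 < δ := half_pos hr
  set η := δ / (4 * ((d : ℝ) + 1)) with hη
  have hη0 : 0 < η := by positivity
  have hηδ : η ≤ δ := div_le_self hδ0.le (by linarith [(Nat.cast_nonneg d : (0 : ℝ) ≤ d)])
  have hev : ∀ᶠ c in 𝓝[>] (0 : ℝ), ∀ i, ∀ᶠ n in atTop,
      ∃ y ∈ Metric.ball (crossPolytopePoint x δ i) η, c ≤ fs n y := by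
    refine eventually_all.2 fun i =>
      eventually_exists_le_of_tendstoInDistribution hfs hf hconv hη0 fun y hy => hpos y ?_
    refine Metric.ball_subset_ball' ?_ hy
    linarith [dist_crossPolytopePoint_le x hδ0 i]
  obtain ⟨c, hc, hc0⟩ := (hev.and self_mem_nhdsWithin).exists
  have hc0 : 0 < c := hc0
  have hvol : 0 < volume.real (Metric.ball x η) :=
    ENNReal.toReal_pos (Metric.measure_ball_pos volume x hη0).ne' measure_ball_lt_top.ne
  refine ⟨(2 ^ d / (√c * volume.real (Metric.ball x η))) ^ 2, by positivity, ?_⟩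
  filter_upwards [eventually_all.2 hc] with n hn
  exact (hfs n).le_of_ball_le hη0 hc0
    (ball_subset_of_crossPolytope ((hfs n).convex_superlevel_s8 hc0) x hδ0 hn)

/-- Mass transport towards `x`: a bound on the tail mass of a bounded log-concave density
controls its values far away. -/
theorem IsLogConcaveDensity.rpow_mul_le_integral_radialCutoff {h : E → ℝ}
    (hh : IsLogConcaveDensity h) {S : ℝ} (hS : 0 < S) (hhS : ∀ x, h x ≤ S) {ρ M : ℝ}
    (hmass : ∫ y, radialCutoff ρ y * h y ≤ 1 / 2) {x : E} {t : ℝ} (ht0 : 0 ≤ t)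
    (ht : t ≤ 1 / 2) (htx : M + ρ ≤ t * ‖x‖) :
    (1 / 2) ^ d * (h x ^ t / S ^ t * (1 / 2)) ≤ ∫ z, radialCutoff M z * h z := by
  have hx0 := hh.2.1 x
  have hint := pow_mul_integral_le_of_le_comp (s := 1 - t) (by linarith) (t • x)
    (φ := fun y => h x ^ t / S ^ t * (h y - radialCutoff ρ y * h y))
    (G := fun z => radialCutoff M z * h z)
    (fun y => by
      have : 0 ≤ h y - radialCutoff ρ y * h y := by
        nlinarith [hh.2.1 y, radialCutoff_le_one ρ y]
      positivity)
    (hh.integrable_radialCutoff_mul M)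
    (fun y => by
      rcases le_total ρ ‖y‖ with hy | hy
      · rw [radialCutoff_eq_one hy, one_mul, sub_self, mul_zero]
        exact mul_nonneg (radialCutoff_nonneg _ _) (hh.2.1 _)
      · have hfar : M ≤ ‖(1 - t) • y + t • x‖ := by
          have h1 : ‖t • x‖ = t * ‖x‖ := by rw [norm_smul, Real.norm_of_nonneg ht0]
          have h2 : ‖(1 - t) • y‖ ≤ ρ := by
            rw [norm_smul, Real.norm_of_nonneg (by linarith)]
            nlinarith [norm_nonneg y]
          have h3 := norm_sub_le ((1 - t) • y + t • x) ((1 - t) • y)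
          rw [add_sub_cancel_left] at h3
          linarith
        rw [radialCutoff_eq_one hfar, one_mul]
        refine le_trans ?_ (hh.2.2.2 y x (1 - t) t (by linarith) ht0 (by ring))
        have hy0 := hh.2.1 y
        have hstep : h y / S ^ t ≤ h y ^ (1 - t) := by
          rcases hy0.eq_or_lt with h0 | h0
          · rw [← h0, zero_div]
            exact Real.rpow_nonneg le_rfl _
          · rw [Real.rpow_sub h0, Real.rpow_one]
            gcongr
            exact hhS y
        calc h x ^ t / S ^ t * (h y - radialCutoff ρ y * h y)
            ≤ h x ^ t / S ^ t * h y := by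
              gcongr
              nlinarith [radialCutoff_nonneg ρ y]
          _ = h y / S ^ t * h x ^ t := by ring
          _ ≤ h y ^ (1 - t) * h x ^ t := by gcongr)
  refine le_trans ?_ hint
  rw [integral_const_mul, integral_sub hh.integrable_s8 (hh.integrable_radialCutoff_mul ρ),
    hh.2.2.1]
  have hs : 1 / 2 ≤ 1 - t := by linarith
  have hm : 1 / 2 ≤ 1 - ∫ y, radialCutoff ρ y * h y := by linarith
  have hs0 : 0 ≤ 1 - t := by linarith
  gcongr

end Envelope

/-- If a sequence of log-concave densities converges in distribution to a log-concave
density `f` with `f x ≤ exp (−a₀‖x‖ + b₀)`, then for every `a < a₀` the sequence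
eventually satisfies a uniform exponential envelope `fₙ x ≤ exp (−a‖x‖ + b)`. -/
theorem logConcave_tendstoInDistribution_uniform_envelope {d : ℕ}
    (fs : ℕ → EuclideanSpace ℝ (Fin d) → ℝ) (hfs : ∀ n, IsLogConcaveDensity (fs n))
    (f : EuclideanSpace ℝ (Fin d) → ℝ) (hf : IsLogConcaveDensity f)
    (hconv : TendstoInDistribution fs f)
    (a₀ : ℝ) (ha₀ : 0 < a₀) (b₀ : ℝ) (hbound : ∀ x, f x ≤ Real.exp (-a₀ * ‖x‖ + b₀))
    (a : ℝ) (ha : a < a₀) :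
    ∃ b : ℝ, ∃ n₀ : ℕ, ∀ n ≥ n₀, ∀ x, fs n x ≤ Real.exp (-a * ‖x‖ + b) := by
  wlog hpos : 0 < a generalizing a
  · obtain ⟨b, n₀, hb⟩ := this (a₀ / 2) (half_lt_self ha₀) (half_pos ha₀)
    refine ⟨b, n₀, fun n hn x => (hb n hn x).trans (Real.exp_le_exp.2 ?_)⟩
    nlinarith [norm_nonneg x]
  obtain ⟨S, hS, hSev⟩ := exists_eventually_le_of_tendstoInDistribution hfs hf hconv
  obtain ⟨a', haa', ha'⟩ := exists_between ha
  have ha'0 : 0 < a' := hpos.trans haa'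
  obtain ⟨C, hC, htail⟩ := exists_integral_radialCutoff_mul_lt hf.2.1 hbound ha'0 ha'
  have hdecay : ∀ {k : ℝ}, 0 < k → Tendsto (fun M : ℝ => Real.exp (-k * M)) atTop (𝓝 0) :=
    fun hk => Real.tendsto_exp_atBot.comp (tendsto_id.const_mul_atTop_of_neg (neg_lt_zero.2 hk))
  obtain ⟨ρ, hρ, hρ0⟩ := (((hdecay ha'0).eventually_lt_const
    (show 0 < 1 / 2 / C by positivity)).and (eventually_ge_atTop 0)).exists
  obtain ⟨M, hM, hM1⟩ := (((hdecay (sub_pos.2 haa')).eventually_lt_const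
    (show 0 < Real.exp (-a * ρ) / (2 ^ d * 2 * C) by positivity)).and
      (eventually_ge_atTop 1)).exists
  rw [lt_div_iff₀ (by positivity)] at hρ hM
  have hcut : ∀ K, ∀ᶠ n in atTop, ∫ x, radialCutoff K x * fs n x < C * Real.exp (-a' * K) :=
    fun K => (hconv (radialCutoff K) (continuous_radialCutoff K)
      ⟨1, abs_radialCutoff_le_one K⟩).eventually_lt_const (htail K)
  obtain ⟨n₀, hn₀⟩ := eventually_atTop.1 (hSev.and ((hcut ρ).and (hcut M)))
  refine ⟨a * (2 * (M + ρ)) + Real.log S, n₀, fun n hn x => ?_⟩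
  obtain ⟨hbd, hmass, hfar⟩ := hn₀ n hn
  rw [← add_assoc, Real.exp_add, Real.exp_log hS]
  rcases le_total ‖x‖ (2 * (M + ρ)) with hx | hx
  · have : 1 ≤ Real.exp (-a * ‖x‖ + a * (2 * (M + ρ))) := Real.one_le_exp (by nlinarith)
    nlinarith [hbd x]
  · have hx0 : 0 < ‖x‖ := by linarith
    set t := (M + ρ) / ‖x‖ with ht
    have ht0 : 0 < t := by positivity
    have htx : t * ‖x‖ = M + ρ := by rw [ht]; field_simp
    have hkey := (hfs n).rpow_mul_le_integral_radialCutoff hS hbd (M := M)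
      (hmass.le.trans (by linarith)) ht0.le (by rw [ht, div_le_iff₀ hx0]; linarith) htx.ge
    have hpow : fs n x ^ t ≤ (S * Real.exp (-a * ‖x‖)) ^ t := by
      rw [Real.mul_rpow hS.le (Real.exp_pos _).le, ← Real.exp_mul, mul_assoc, mul_comm ‖x‖ t,
        htx, mul_comm, ← div_le_iff₀ (Real.rpow_pos_of_pos hS t)]
      have e1 : Real.exp (-a' * M) = Real.exp (-(a' - a) * M) * Real.exp (-a * M) := by
        rw [← Real.exp_add]; ring_nf
      have e2 : Real.exp (-a * (M + ρ)) = Real.exp (-a * ρ) * Real.exp (-a * M) := by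
        rw [← Real.exp_add]; ring_nf
      have h1 := hkey.trans hfar.le
      rw [one_div, inv_pow, inv_mul_le_iff₀ (by positivity)] at h1
      have h2 := mul_le_mul_of_nonneg_right hM.le (Real.exp_pos (-a * M)).le
      rw [e1] at h1
      rw [e2]
      linarith
    have hle := (Real.rpow_le_rpow_iff ((hfs n).2.1 x) (by positivity) ht0).1 hpow
    refine hle.trans ?_
    rw [mul_comm]
    gcongr
    have : 0 ≤ a * (2 * (M + ρ)) := by positivity
    linarith
end

section
/- Let φ : ℝ^d → [−∞,∞) be a concave function that attains its maximum value M ∈ ℝ at some point of ℝ^d, and let s < t ≤ M with s ∈ ℝ. Then the Lebesgue measures of the superlevel sets satisfy μ({x : φ(x) ≥ t}) ≥ ((M − t)/(M − s))^d · μ({x : φ(x) ≥ s}). -/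
open MeasureTheory

/-- For a concave function `φ : ℝ^d → [−∞,∞)` (concavity expressed via convexity of
the hypograph) attaining its maximum value `M ∈ ℝ`, the Lebesgue measures of the
superlevel sets satisfy
`μ {φ ≥ t} ≥ ((M − t)/(M − s))^d · μ {φ ≥ s}` whenever `s < t ≤ M`. -/
theorem concave_superlevel_measure_bound {d : ℕ}
    (φ : EuclideanSpace ℝ (Fin d) → EReal)
    (hconc : Convex ℝ {p : EuclideanSpace ℝ (Fin d) × ℝ | (p.2 : EReal) ≤ φ p.1})
    (M : ℝ) (x₀ : EuclideanSpace ℝ (Fin d)) (hmax : φ x₀ = (M : EReal))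
    (hub : ∀ x, φ x ≤ (M : EReal))
    (s t : ℝ) (hst : s < t) (htM : t ≤ M) :
    ENNReal.ofReal (((M - t) / (M - s)) ^ d) * volume {x | (s : EReal) ≤ φ x}
      ≤ volume {x | (t : EReal) ≤ φ x} := by
  have hs : 0 < M - s := by linarith
  set r : ℝ := (M - t) / (M - s) with hr
  have hr0 : 0 ≤ r := div_nonneg (by linarith) hs.le
  have hr1 : r ≤ 1 := (div_le_one hs).2 (by linarith)
  have hrt : r * s + (1 - r) * M = t := by
    rw [hr]
    field_simp
    ring
  have hvol := Measure.addHaar_image_homothety (volume : Measure (EuclideanSpace ℝ (Fin d)))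
    x₀ r {x | (s : EReal) ≤ φ x}
  rw [finrank_euclideanSpace_fin, abs_of_nonneg (pow_nonneg hr0 d)] at hvol
  rw [← hvol]
  refine measure_mono ?_
  rintro _ ⟨y, hy, rfl⟩
  have hx₀ : (x₀, M) ∈ {p : EuclideanSpace ℝ (Fin d) × ℝ | (p.2 : EReal) ≤ φ p.1} := hmax.ge
  have hys : (y, s) ∈ {p : EuclideanSpace ℝ (Fin d) × ℝ | (p.2 : EReal) ≤ φ p.1} := hy
  have hcomb := hconc hys hx₀ hr0 (sub_nonneg.2 hr1) (add_sub_cancel r 1)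
  have hpt : AffineMap.homothety x₀ r y = r • y + (1 - r) • x₀ := by
    simp only [AffineMap.homothety_apply, vsub_eq_sub, vadd_eq_add]
    module
  simpa [hpt, hrt] using hcomb
end
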